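/- arXiv:math/0511607 — 3 statements merged into one kernel-verified Lean document; each statement's English description precedes it below -/
import Mathlib

section
/- Let n be a positive integer, p ∈ [0,1], f a real function on {0,1}^n, and for j ∈ {1,…,n} let V_j = E[f | x_1,…,x_j] − E[f | x_1,…,x_{j−1}] denote the martingale increments of f with respect to the coordinate filtration under μ_{n,p}. Then for every i ∈ {1,…,n}: ∑_{j=1}^n ∫ V_j · Δ_i V_j dμ_{n,p} = ∫ f · Δ_i f dμ_{n,p}. -/
open Finset

/-- Weight of a point `x ∈ {0,1}^n` under the product Bernoulli(p) measure:
`p^{∑ xᵢ} (1-p)^{∑ (1-xᵢ)}`. -/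
noncomputable def muW (n : ℕ) (p : ℝ) (x : Fin n → Bool) : ℝ :=
  ∏ i : Fin n, if x i then p else 1 - p

/-- The measure `μ_{n,p}(A)` of a subset `A ⊆ {0,1}^n`. -/
noncomputable def muP (n : ℕ) (p : ℝ) (A : Finset (Fin n → Bool)) : ℝ :=
  ∑ x ∈ A, muW n p x

/-- Expectation `∫ f dμ_{n,p}` of a real function on `{0,1}^n`. -/
noncomputable def muE (n : ℕ) (p : ℝ) (f : (Fin n → Bool) → ℝ) : ℝ :=
  ∑ x : Fin n → Bool, muW n p x * f x

/-- `A` is monotone: `x ∈ A` and `x ≤ y` coordinatewise imply `y ∈ A`. -/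
def MonotoneSet (n : ℕ) (A : Finset (Fin n → Bool)) : Prop :=
  ∀ x ∈ A, ∀ y : Fin n → Bool, (∀ i, x i ≤ y i) → y ∈ A

/-- `A` is symmetric: invariant under a transitive subgroup of permutations of coordinates. -/
def SymmetricSet (n : ℕ) (A : Finset (Fin n → Bool)) : Prop :=
  ∃ G : Subgroup (Equiv.Perm (Fin n)),
    (∀ i j : Fin n, ∃ g ∈ G, g i = j) ∧
    (∀ g ∈ G, ∀ x ∈ A, (fun i => x (g⁻¹ i)) ∈ A)

/-- Discrete gradient `∇_i f`. -/
noncomputable def grad (n : ℕ) (i : Fin n) (f : (Fin n → Bool) → ℝ)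
    (x : Fin n → Bool) : ℝ :=
  f (Function.update x i true) - f (Function.update x i false)

/-- The operator `Δ_i f = f - ∫ f dμ_{1,p}(x_i)`. -/
noncomputable def del (n : ℕ) (p : ℝ) (i : Fin n) (f : (Fin n → Bool) → ℝ)
    (x : Fin n → Bool) : ℝ :=
  f x - (p * f (Function.update x i true) + (1 - p) * f (Function.update x i false))

open Classical in
/-- Influence of coordinate `i` on a function `f`: the `μ_{n,p}`-probability
that `f` is not constant on the `i`-th fiber. -/
noncomputable def infl (n : ℕ) (p : ℝ) (i : Fin n) (f : (Fin n → Bool) → ℝ) : ℝ :=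
  muP n p (Finset.univ.filter fun x =>
    f (Function.update x i true) ≠ f (Function.update x i false))

open Classical in
/-- Influence of coordinate `i` on a set `A`. -/
noncomputable def inflSet (n : ℕ) (p : ℝ) (i : Fin n) (A : Finset (Fin n → Bool)) : ℝ :=
  muP n p (Finset.univ.filter fun x =>
    ¬((Function.update x i true ∈ A) ↔ (Function.update x i false ∈ A)))

/-- Entropy of a (nonnegative) function with respect to `μ_{n,p}`. -/
noncomputable def ent (n : ℕ) (p : ℝ) (g : (Fin n → Bool) → ℝ) : ℝ :=
  muE n p (fun x => g x * Real.log (g x)) - muE n p g * Real.log (muE n p g)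

/-- Variance of a function with respect to `μ_{n,p}`. -/
noncomputable def varE (n : ℕ) (p : ℝ) (f : (Fin n → Bool) → ℝ) : ℝ :=
  muE n p (fun x => f x ^ 2) - (muE n p f) ^ 2

/-- Conditional expectation `E[f | x_1, …, x_j]` under `μ_{n,p}`:
average over the last `n - j` coordinates. -/
noncomputable def condE (n : ℕ) (p : ℝ) (j : ℕ) (f : (Fin n → Bool) → ℝ)
    (x : Fin n → Bool) : ℝ :=
  ∑ y : Fin n → Bool,
    (∏ i : Fin n, if (i : ℕ) < j then (if y i = x i then (1 : ℝ) else 0)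
      else (if y i then p else 1 - p)) * f y

/-- The logarithmic Sobolev constant of the two-point Bernoulli(p) space. -/
noncomputable def cLS (p : ℝ) : ℝ :=
  if p = 1 / 2 then 2 else (Real.log (1 - p) - Real.log p) / (1 - 2 * p)

/-- The sequence `s(n)` of Theorem 4.1. -/
noncomputable def sseq (n : ℕ) : ℝ :=
  Real.log n -
    max (Real.log ((Real.exp 1 ^ (2 + 4 / Real.exp 1) / (2 : ℝ) ^ (5 + 4 / Real.exp 1)) *
        Real.log ((n : ℝ) / Real.log n ^ 2) ^ (3 + 4 / Real.exp 1)))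
      (2 * Real.log (Real.log n))

/-- Tensor product of two-by-two kernels. -/
noncomputable def tens (n : ℕ) (M : Fin n → Matrix Bool Bool ℝ) :
    Matrix (Fin n → Bool) (Fin n → Bool) ℝ :=
  Matrix.of fun x y => ∏ k, M k (x k) (y k)

lemma tens_mul (n : ℕ) (M N : Fin n → Matrix Bool Bool ℝ) :
    tens n M * tens n N = tens n (fun k => M k * N k) := by
  ext x y
  simp only [tens, Matrix.mul_apply, Matrix.of_apply, Finset.prod_univ_sum, Finset.prod_mul_distrib,
    Fintype.piFinset_univ]

lemma tens_one (n : ℕ) : tens n (fun _ => 1) = 1 := by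
  ext x y
  simp only [tens, Matrix.of_apply, Matrix.one_apply, Finset.prod_ite_zero, Finset.prod_const_one,
    funext_iff, Finset.mem_univ, true_implies]

/-- Averaging kernel. -/
noncomputable def avg (p : ℝ) : Matrix Bool Bool ℝ :=
  Matrix.of fun _ b => if b then p else 1 - p

lemma avg_mul (p : ℝ) : avg p * avg p = avg p := by
  ext a b
  simp only [avg, Matrix.mul_apply, Matrix.of_apply, Fintype.sum_bool]
  cases b <;> simp <;> ring

/-- Kernel of the conditional expectation. -/
noncomputable def cK (n : ℕ) (p : ℝ) (j : ℕ) : Matrix (Fin n → Bool) (Fin n → Bool) ℝ :=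
  tens n (fun k => if (k : ℕ) < j then 1 else avg p)

/-- Kernel of averaging in coordinate i. -/
noncomputable def aK (n : ℕ) (p : ℝ) (i : Fin n) : Matrix (Fin n → Bool) (Fin n → Bool) ℝ :=
  tens n (fun k => if k = i then avg p else 1)

lemma condE_eq (n : ℕ) (p : ℝ) (j : ℕ) (f : (Fin n → Bool) → ℝ) :
    condE n p j f = (cK n p j).mulVec f := by
  ext x
  simp only [condE, cK, tens, Matrix.mulVec, dotProduct, Matrix.of_apply]
  refine Finset.sum_congr rfl fun y _ => ?_
  congr 1
  refine Finset.prod_congr rfl fun k _ => ?_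
  by_cases h : (k : ℕ) < j
  · simp only [h, if_true, Matrix.one_apply, eq_comm (a := y k)]
  · simp only [h, if_false, avg, Matrix.of_apply]

lemma aK_apply (n : ℕ) (p : ℝ) (i : Fin n) (x y : Fin n → Bool) :
    aK n p i x y = p * (if y = Function.update x i true then 1 else 0)
      + (1 - p) * (if y = Function.update x i false then 1 else 0) := by
  have h : aK n p i x y = (if y i then p else 1 - p) *
      (if ∀ k, k ≠ i → x k = y k then 1 else 0) := by
    simp only [aK, tens, Matrix.of_apply]
    rw [← Finset.mul_prod_erase _ _ (Finset.mem_univ i)]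
    congr 1
    · simp [avg]
    · rw [Finset.prod_congr rfl (g := fun k => if x k = y k then (1 : ℝ) else 0)]
      · simp [Finset.prod_ite_zero]
      · intro k hk
        simp [Finset.ne_of_mem_erase hk, Matrix.one_apply]
  have e : ∀ b, y = Function.update x i b ↔ (y i = b ∧ ∀ k, k ≠ i → x k = y k) := by
    intro b
    rw [Function.eq_update_iff]
    simp [eq_comm]
  rw [h]
  simp only [e]
  cases y i <;> simp

lemma del_eq (n : ℕ) (p : ℝ) (i : Fin n) (f : (Fin n → Bool) → ℝ) :
    del n p i f = (1 - aK n p i).mulVec f := by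
  ext x
  rw [Matrix.sub_mulVec, Matrix.one_mulVec]
  simp only [del, Pi.sub_apply, Matrix.mulVec, dotProduct, aK_apply, add_mul,
    Finset.sum_add_distrib, mul_assoc, ← Finset.mul_sum, ite_mul, one_mul, zero_mul,
    Finset.sum_ite_eq', Finset.sum_ite_eq, Finset.mem_univ, if_true]

lemma muE_eq (n : ℕ) (p : ℝ) (g h : (Fin n → Bool) → ℝ) :
    muE n p (fun x => g x * h x) = g ⬝ᵥ (Matrix.diagonal (muW n p)).mulVec h := by
  simp only [muE, dotProduct, Matrix.mulVec_diagonal]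
  exact Finset.sum_congr rfl fun x _ => by ring

lemma cK_symm (n : ℕ) (p : ℝ) (j : ℕ) :
    (cK n p j).transpose * Matrix.diagonal (muW n p) = Matrix.diagonal (muW n p) * cK n p j := by
  ext x y
  simp only [Matrix.mul_diagonal, Matrix.diagonal_mul, Matrix.transpose_apply, cK, tens,
    Matrix.of_apply, muW, ← Finset.prod_mul_distrib]
  refine Finset.prod_congr rfl fun k _ => ?_
  by_cases h : (k : ℕ) < j
  · simp only [h, if_true, Matrix.one_apply]
    cases x k <;> cases y k <;> simp
  · simp only [h, if_false, avg, Matrix.of_apply]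

lemma cK_mul_succ (n : ℕ) (p : ℝ) (j : ℕ) : cK n p (j + 1) * cK n p j = cK n p j := by
  rw [cK, cK, tens_mul]
  congr 1; ext1 k
  split_ifs <;> first | omega | simp [avg_mul]

lemma cK_succ_mul (n : ℕ) (p : ℝ) (j : ℕ) : cK n p j * cK n p (j + 1) = cK n p j := by
  rw [cK, cK, tens_mul]
  congr 1; ext1 k
  split_ifs <;> first | omega | simp [avg_mul]

lemma cK_idem (n : ℕ) (p : ℝ) (j : ℕ) : cK n p j * cK n p j = cK n p j := by
  rw [cK, tens_mul]
  congr 1; ext1 k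
  split_ifs <;> simp [avg_mul]

lemma cK_aK (n : ℕ) (p : ℝ) (j : ℕ) (i : Fin n) : cK n p j * aK n p i = aK n p i * cK n p j := by
  rw [cK, aK, tens_mul, tens_mul]
  congr 1; ext1 k
  split_ifs <;> simp

lemma aK_cK_zero (n : ℕ) (p : ℝ) (i : Fin n) : aK n p i * cK n p 0 = cK n p 0 := by
  rw [cK, aK, tens_mul]
  congr 1; ext1 k
  split_ifs <;> simp_all [avg_mul]

lemma cK_top (n : ℕ) (p : ℝ) : cK n p n = 1 := by
  rw [← tens_one, cK]
  congr 1; ext1 k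
  simp

lemma term_eq (n : ℕ) (p : ℝ) (f : (Fin n → Bool) → ℝ) (i : Fin n) (j : ℕ) :
    muE n p (fun x => (condE n p (j + 1) f x - condE n p j f x) *
          del n p i (fun y => condE n p (j + 1) f y - condE n p j f y) x) =
      f ⬝ᵥ (Matrix.diagonal (muW n p) * ((1 - aK n p i) * cK n p (j + 1))).mulVec f -
      f ⬝ᵥ (Matrix.diagonal (muW n p) * ((1 - aK n p i) * cK n p j)).mulVec f := by
  have hV : (fun y => condE n p (j + 1) f y - condE n p j f y) =
      (cK n p (j + 1) - cK n p j).mulVec f := by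
    rw [Matrix.sub_mulVec, ← condE_eq, ← condE_eq]; rfl
  rw [muE_eq n p (fun y => condE n p (j + 1) f y - condE n p j f y), hV, del_eq]
  generalize hD : cK n p (j + 1) - cK n p j = D
  have hs : D.transpose * Matrix.diagonal (muW n p) = Matrix.diagonal (muW n p) * D := by
    rw [← hD, Matrix.transpose_sub, sub_mul, mul_sub, cK_symm, cK_symm]
  have hi : D * D = D := by
    rw [← hD, sub_mul, mul_sub, mul_sub, cK_idem, cK_idem, cK_mul_succ, cK_succ_mul]; abel
  have hc : D * (1 - aK n p i) = (1 - aK n p i) * D := by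
    rw [mul_sub, sub_mul, mul_one, one_mul, ← hD, sub_mul, mul_sub, cK_aK, cK_aK]
  have key : D.transpose * (Matrix.diagonal (muW n p) * (1 - aK n p i) * D) =
      Matrix.diagonal (muW n p) * ((1 - aK n p i) * D) := by
    rw [mul_assoc, ← mul_assoc D.transpose, hs, mul_assoc, ← mul_assoc D, hc, mul_assoc _ D D, hi]
  rw [Matrix.mulVec_mulVec, Matrix.mulVec_mulVec, ← Matrix.vecMul_transpose,
    ← Matrix.dotProduct_mulVec, Matrix.mulVec_mulVec, ← dotProduct_sub, ← Matrix.sub_mulVec,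
    ← mul_sub, ← mul_sub, hD, key]

/-- claim (10): the energies of the martingale increments
`V_j = E[f | x_1,…,x_j] − E[f | x_1,…,x_{j−1}]` sum to the energy of `f`:
`∑_j ∫ V_j Δᵢ V_j dμ_p = ∫ f Δᵢ f dμ_p` for every `i`. -/
theorem stmt12 (n : ℕ) (hn : 0 < n) (p : ℝ) (hp : p ∈ Set.Icc (0 : ℝ) 1)
    (f : (Fin n → Bool) → ℝ) (i : Fin n) :
    ∑ j ∈ Finset.range n,
        muE n p (fun x => (condE n p (j + 1) f x - condE n p j f x) *
          del n p i (fun y => condE n p (j + 1) f y - condE n p j f y) x) =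
      muE n p (fun x => f x * del n p i f x) := by
  rw [Finset.sum_congr rfl fun j _ => term_eq n p f i j,
    Finset.sum_range_sub (fun j => f ⬝ᵥ
      (Matrix.diagonal (muW n p) * ((1 - aK n p i) * cK n p j)).mulVec f),
    muE_eq, del_eq, cK_top, sub_mul 1 (aK n p i) (cK n p 0), aK_cK_zero]
  simp [Matrix.mulVec_mulVec]
end

section
/- Let n ≥ 2 be an integer, p ∈ (0,1), and let f : {0,1}^n → {0,1} be a nonconstant Boolean function. Set Δ = max_{1 ≤ j ≤ n} ∫ (Δ_j f)² dμ_{n,p}. Then Δ ≥ (Var_{μ_{n,p}}(f) / (n · c_LS(p))) · min{ log( n/(log n)² ), log( n · c_LS(p)^{3+4/e} / ( e^{2+4/e} · Var_{μ_{n,p}}(f) · (log(n/(log n)²))^{3+4/e} ) ) }. -/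
open Finset

/-! ### Recursive structure in the dimension -/

lemma aux_muE_succ (n : ℕ) (p : ℝ) (f : (Fin (n + 1) → Bool) → ℝ) :
    muE (n + 1) p f = p * muE n p (fun x => f (Fin.cons true x))
      + (1 - p) * muE n p (fun x => f (Fin.cons false x)) := by
  unfold muE
  rw [← (Fin.consEquiv (fun _ : Fin (n + 1) => Bool)).sum_comp, Fintype.sum_prod_type,
    Fintype.sum_bool, Finset.mul_sum, Finset.mul_sum]
  congr 1 <;>
  · refine Finset.sum_congr rfl fun x _ => ?_
    simp [muW, Fin.prod_univ_succ, Fin.consEquiv, mul_assoc]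

lemma aux_muE_zero (p : ℝ) (f : (Fin 0 → Bool) → ℝ) (x : Fin 0 → Bool) :
    muE 0 p f = f x := by
  unfold muE muW
  rw [Fintype.sum_unique]
  simp
  congr 1
  exact Subsingleton.elim _ _

lemma aux_del_zero (n : ℕ) (p : ℝ) (f : (Fin (n + 1) → Bool) → ℝ) (b : Bool) (x : Fin n → Bool) :
    del (n + 1) p 0 f (Fin.cons b x) = f (Fin.cons b x)
      - (p * f (Fin.cons true x) + (1 - p) * f (Fin.cons false x)) := by
  unfold del
  rw [Fin.update_cons_zero, Fin.update_cons_zero]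

lemma aux_del_succ (n : ℕ) (p : ℝ) (j : Fin n) (f : (Fin (n + 1) → Bool) → ℝ) (b : Bool)
    (x : Fin n → Bool) :
    del (n + 1) p j.succ f (Fin.cons b x) = del n p j (fun y => f (Fin.cons b y)) x := by
  unfold del
  rw [← Fin.cons_update, ← Fin.cons_update]

lemma aux_muW_nonneg (n : ℕ) {p : ℝ} (hp : p ∈ Set.Ioo (0 : ℝ) 1) (x : Fin n → Bool) :
    0 ≤ muW n p x := by
  unfold muW
  refine Finset.prod_nonneg fun i _ => ?_
  split_ifs
  · exact hp.1.le
  · linarith [hp.2]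

lemma aux_muE_mono (n : ℕ) {p : ℝ} (hp : p ∈ Set.Ioo (0 : ℝ) 1) {f g : (Fin n → Bool) → ℝ}
    (h : ∀ x, f x ≤ g x) : muE n p f ≤ muE n p g :=
  Finset.sum_le_sum fun x _ => mul_le_mul_of_nonneg_left (h x) (aux_muW_nonneg n hp x)

lemma aux_muE_nonneg (n : ℕ) {p : ℝ} (hp : p ∈ Set.Ioo (0 : ℝ) 1) {f : (Fin n → Bool) → ℝ}
    (h : ∀ x, 0 ≤ f x) : 0 ≤ muE n p f :=
  Finset.sum_nonneg fun x _ => mul_nonneg (aux_muW_nonneg n hp x) (h x)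

lemma aux_muE_add (n : ℕ) (p : ℝ) (f g : (Fin n → Bool) → ℝ) :
    muE n p (fun x => f x + g x) = muE n p f + muE n p g := by
  simp [muE, mul_add, Finset.sum_add_distrib]

lemma aux_muE_smul (n : ℕ) (p a : ℝ) (f : (Fin n → Bool) → ℝ) :
    muE n p (fun x => a * f x) = a * muE n p f := by
  unfold muE
  rw [Finset.mul_sum]
  exact Finset.sum_congr rfl fun x _ => by ring

lemma aux_muE_one (n : ℕ) (p : ℝ) : muE n p (fun _ => 1) = 1 := by
  induction n with
  | zero => exact aux_muE_zero p _ default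
  | succ n ih => rw [aux_muE_succ, ih]; ring

lemma aux_cauchy (n : ℕ) {p : ℝ} (hp : p ∈ Set.Ioo (0 : ℝ) 1) (f g : (Fin n → Bool) → ℝ) :
    muE n p (fun x => f x * g x) ^ 2 ≤ muE n p (fun x => f x ^ 2) * muE n p (fun x => g x ^ 2) := by
  unfold muE
  refine Finset.sum_sq_le_sum_mul_sum_of_sq_le_mul _ (fun x _ => ?_) (fun x _ => ?_) (fun x _ => ?_)
  · exact mul_nonneg (aux_muW_nonneg n hp x) (sq_nonneg _)
  · exact mul_nonneg (aux_muW_nonneg n hp x) (sq_nonneg _)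
  · apply le_of_eq; ring

/-- Reverse triangle inequality in `L²`. -/
lemma aux_minkowski (n : ℕ) {p : ℝ} (hp : p ∈ Set.Ioo (0 : ℝ) 1) (f g : (Fin n → Bool) → ℝ) :
    (√(muE n p (fun x => f x ^ 2)) - √(muE n p (fun x => g x ^ 2))) ^ 2
      ≤ muE n p (fun x => (f x - g x) ^ 2) := by
  have h1 : muE n p (fun x => (f x - g x) ^ 2) = muE n p (fun x => f x ^ 2)
      - 2 * muE n p (fun x => f x * g x) + muE n p (fun x => g x ^ 2) := by
    unfold muE
    rw [Finset.mul_sum, ← Finset.sum_sub_distrib, ← Finset.sum_add_distrib]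
    exact Finset.sum_congr rfl fun x _ => by ring
  have hf : 0 ≤ muE n p (fun x => f x ^ 2) := aux_muE_nonneg n hp fun x => sq_nonneg _
  have hg : 0 ≤ muE n p (fun x => g x ^ 2) := aux_muE_nonneg n hp fun x => sq_nonneg _
  have hc : muE n p (fun x => f x * g x)
      ≤ √(muE n p (fun x => f x ^ 2)) * √(muE n p (fun x => g x ^ 2)) := by
    rw [← Real.sqrt_mul hf]
    exact Real.le_sqrt_of_sq_le (aux_cauchy n hp f g)
  rw [h1, sub_sq, Real.sq_sqrt hf, Real.sq_sqrt hg]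
  linarith

/-! ### The two-point logarithmic Sobolev inequality -/

lemma aux_cLS_pos {p : ℝ} (hp : p ∈ Set.Ioo (0 : ℝ) 1) : 0 < cLS p := by
  obtain ⟨h0, h1⟩ := hp
  unfold cLS
  split_ifs with h
  · norm_num
  · rcases lt_or_gt_of_ne h with h | h
    · have := Real.log_lt_log h0 (by linarith : p < 1 - p)
      exact div_pos (by linarith) (by linarith)
    · have := Real.log_lt_log (by linarith) (by linarith : 1 - p < p)
      exact div_pos_of_neg_of_neg (by linarith) (by linarith)

lemma aux_cLS_symm (p : ℝ) : cLS (1 - p) = cLS p := by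
  unfold cLS
  by_cases h : p = 1 / 2
  · subst h; norm_num
  · have h' : ¬ (1 - p = 1 / 2) := fun h2 => h (by linarith)
    rw [if_neg h, if_neg h', ← neg_div_neg_eq]
    congr 1 <;> ring_nf

lemma aux_int_rpow {a : ℝ} (ha : 0 < a) (ha1 : a ≠ 1) :
    ∫ t in (0 : ℝ)..1, a ^ t = (a - 1) / Real.log a := by
  have hl : Real.log a ≠ 0 := Real.log_ne_zero_of_pos_of_ne_one ha ha1
  have hd : ∀ t ∈ Set.uIcc (0 : ℝ) 1, HasDerivAt (fun t : ℝ => a ^ t / Real.log a) (a ^ t) t := by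
    intro t _
    have := (Real.hasStrictDerivAt_const_rpow ha t).hasDerivAt.div_const (Real.log a)
    rwa [mul_div_cancel_right₀ _ hl] at this
  rw [intervalIntegral.integral_eq_sub_of_hasDerivAt hd]
  · simp [sub_div]
  · exact (Real.continuous_const_rpow ha.ne').intervalIntegrable _ _

/-- The inverse of the log-Sobolev constant is the logarithmic mean of `1-p` and `p`. -/
lemma aux_cLS_int {p : ℝ} (hp : p ∈ Set.Ioo (0 : ℝ) 1) :
    ∫ t in (0 : ℝ)..1, p * ((1 - p) / p) ^ t = 1 / cLS p := by
  obtain ⟨h0, h1⟩ := hp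
  have hq : 0 < 1 - p := by linarith
  rw [intervalIntegral.integral_const_mul]
  unfold cLS
  split_ifs with h
  · subst h; norm_num
  · have hne : (1 - p) / p ≠ 1 := by
      intro h2
      rw [div_eq_one_iff_eq h0.ne'] at h2
      exact h (by linarith)
    rw [aux_int_rpow (by positivity) hne, Real.log_div hq.ne' h0.ne', one_div_div]
    field_simp
    ring

lemma aux_key {p A B : ℝ} (hp : p ∈ Set.Ioo (0 : ℝ) 1) (hA : 1 < A) (hB0 : 0 < B) (hB : B < 1)
    (hm : p * A + (1 - p) * B = 1) :
    1 / cLS p ≤ (1 - p) / Real.log A + p / Real.log B := by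
  obtain ⟨h0, h1⟩ := hp
  have hq : 0 < 1 - p := by linarith
  have hA0 : 0 < A := by linarith
  have hAB : 0 < A - B := by linarith
  have hpe : p = (1 - B) / (A - B) := by field_simp; linarith
  have hqe : 1 - p = (A - 1) / (A - B) := by field_simp; linarith
  have hpt : ∀ t ∈ Set.Icc (0 : ℝ) 1, (A - B) * (p * ((1 - p) / p) ^ t) ≤ A ^ t - B * (B⁻¹) ^ t := by
    rintro t ⟨ht0, ht1⟩
    have e1 : (A - B) * (p * ((1 - p) / p) ^ t)
        = A ^ t * (((A - 1) / A) ^ t * (1 - B) ^ (1 - t)) := by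
      have : (1 - p) / p = ((A - 1) / A) * A / (1 - B) := by
        rw [hqe, hpe]; 
        have : 1 - B ≠ 0 := by linarith
        field_simp
      rw [this, Real.div_rpow (by
          have : 0 < A - 1 := by linarith
          positivity) (by linarith), Real.mul_rpow (by
          have : 0 < A - 1 := by linarith
          positivity) hA0.le, Real.rpow_sub (by linarith), Real.rpow_one]
      have : (A - B) * p = 1 - B := by rw [hpe]; field_simp
      rw [← mul_assoc, this]
      ring
    have e2 : B * (B⁻¹) ^ t = A ^ t * ((1 / A) ^ t * B ^ (1 - t)) := by
      rw [Real.inv_rpow hB0.le, Real.rpow_sub hB0, Real.rpow_one, Real.div_rpow zero_le_one hA0.le,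
        Real.one_rpow]
      have : A ^ t ≠ 0 := (Real.rpow_pos_of_pos hA0 t).ne'
      field_simp
    have g1 := Real.geom_mean_le_arith_mean2_weighted ht0 (sub_nonneg.2 ht1)
      (div_nonneg (by linarith : 0 ≤ A - 1) hA0.le) (by linarith : 0 ≤ 1 - B) (by ring)
    have g2 := Real.geom_mean_le_arith_mean2_weighted ht0 (sub_nonneg.2 ht1)
      (by positivity : 0 ≤ 1 / A) hB0.le (by ring)
    have g3 : t * ((A - 1) / A) + (1 - t) * (1 - B) + (t * (1 / A) + (1 - t) * B) = 1 := by
      field_simp; ring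
    have := mul_le_mul_of_nonneg_left (by linarith :
      ((A - 1) / A) ^ t * (1 - B) ^ (1 - t) + (1 / A) ^ t * B ^ (1 - t) ≤ 1)
      (Real.rpow_pos_of_pos hA0 t).le
    rw [e1, e2]
    linarith
  have cont : ∀ a : ℝ, 0 < a → Continuous (fun t : ℝ => a ^ t) := fun a ha =>
    Real.continuous_const_rpow ha.ne'
  have hI := intervalIntegral.integral_mono_on (μ := MeasureTheory.volume) zero_le_one
    ((((cont _ (div_pos hq h0)).const_mul p).const_mul (A - B)).intervalIntegrable 0 1)
    (((cont A hA0).sub ((cont _ (inv_pos.2 hB0)).const_mul B)).intervalIntegrable 0 1) hpt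
  simp only [Pi.sub_apply] at hI
  rw [intervalIntegral.integral_const_mul, aux_cLS_int ⟨h0, h1⟩,
    intervalIntegral.integral_sub ((cont A hA0).intervalIntegrable 0 1)
      (((cont _ (inv_pos.2 hB0)).const_mul B).intervalIntegrable 0 1),
    intervalIntegral.integral_const_mul, aux_int_rpow hA0 hA.ne',
    aux_int_rpow (inv_pos.2 hB0) (by rw [ne_eq, inv_eq_one]; exact hB.ne), Real.log_inv] at hI
  have hlA : 0 < Real.log A := Real.log_pos hA
  have hlB : Real.log B < 0 := Real.log_neg hB0 hB
  have e3 : (A - 1) / Real.log A - B * ((B⁻¹ - 1) / -Real.log B)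
      = (A - B) * ((1 - p) / Real.log A + p / Real.log B) := by
    have a1 : A - 1 = (A - B) * (1 - p) := by rw [hqe]; field_simp
    have a2 : B * (B⁻¹ - 1) = (A - B) * p := by
      rw [hpe]; field_simp
    rw [a1, div_neg, mul_neg, ← mul_div_assoc, a2]
    ring
  rw [e3] at hI
  exact le_of_mul_le_mul_left hI hAB

/-- Normalized two-point inequality. -/
lemma aux_two_norm {p a b : ℝ} (hp : p ∈ Set.Ioo (0 : ℝ) 1) (hb : 0 < b) (hab : b < a)
    (hm : p * a ^ 2 + (1 - p) * b ^ 2 = 1) :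
    p * (a ^ 2 * Real.log (a ^ 2)) + (1 - p) * (b ^ 2 * Real.log (b ^ 2))
      ≤ cLS p * (p * (1 - p) * (a - b) ^ 2) := by
  have hc := aux_cLS_pos hp
  have h0 := hp.1
  have hq : 0 < 1 - p := by linarith [hp.2]
  have hab2 : b ^ 2 < a ^ 2 := by nlinarith
  have hA : 1 < a ^ 2 := by nlinarith
  have hB : b ^ 2 < 1 := by nlinarith
  have key := aux_key hp hA (by positivity) hB hm
  have hlA : 0 < Real.log (a ^ 2) := Real.log_pos hA
  have hlB : Real.log (b ^ 2) < 0 := Real.log_neg (by positivity) hB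
  generalize Real.log (a ^ 2) = α at *
  obtain ⟨β, hβ⟩ : ∃ β, β = -Real.log (b ^ 2) := ⟨_, rfl⟩
  have hβ' : Real.log (b ^ 2) = -β := by linarith
  rw [hβ'] at key hlB ⊢
  have hβ0 : 0 < β := by linarith
  generalize cLS p = c at *
  have k2 : α * β ≤ c * ((1 - p) * β - p * α) := by
    have : (1 - p) / α + p / -β = ((1 - p) * β - p * α) / (α * β) := by
      field_simp; ring
    rw [this, div_le_div_iff₀ hc (by positivity)] at key
    linarith
  have k3 : 0 < c * (1 - p) - α := by
    have : 0 < β * (c * (1 - p) - α) := by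
      have : 0 < c * (p * α) := by positivity
      nlinarith
    exact (mul_pos_iff_of_pos_left hβ0).1 this
  have k4 : 0 ≤ (c * (1 - p) - α) * (p * ((c * (1 - p) - α)) * a ^ 2
      - 2 * c * p * (1 - p) * a * b + (1 - p) * (c * p + β) * b ^ 2) := by
    have e : (c * (1 - p) - α) * (p * ((c * (1 - p) - α)) * a ^ 2
      - 2 * c * p * (1 - p) * a * b + (1 - p) * (c * p + β) * b ^ 2)
      = p * ((c * (1 - p) - α) * a - c * (1 - p) * b) ^ 2
        + (1 - p) * b ^ 2 * (c * ((1 - p) * β - p * α) - α * β) := by ring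
    rw [e]
    have : 0 ≤ c * ((1 - p) * β - p * α) - α * β := by linarith
    positivity
  have k5 := nonneg_of_mul_nonneg_right k4 k3
  linarith

lemma aux_two_pos {p a b : ℝ} (hp : p ∈ Set.Ioo (0 : ℝ) 1) (hb : 0 < b) (hab : b < a) :
    p * (a ^ 2 * Real.log (a ^ 2)) + (1 - p) * (b ^ 2 * Real.log (b ^ 2))
      - (p * a ^ 2 + (1 - p) * b ^ 2) * Real.log (p * a ^ 2 + (1 - p) * b ^ 2)
      ≤ cLS p * (p * (1 - p) * (a - b) ^ 2) := by
  have h0 := hp.1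
  have hq : 0 < 1 - p := by linarith [hp.2]
  have ha : 0 < a := by linarith
  have hm : 0 < p * a ^ 2 + (1 - p) * b ^ 2 := by positivity
  obtain ⟨s, hs⟩ : ∃ s, s = √(p * a ^ 2 + (1 - p) * b ^ 2) := ⟨_, rfl⟩
  have hs0 : 0 < s := by rw [hs]; exact Real.sqrt_pos.2 hm
  have hs2 : p * a ^ 2 + (1 - p) * b ^ 2 = s ^ 2 := by rw [hs, Real.sq_sqrt hm.le]
  have := aux_two_norm hp (div_pos hb hs0) (div_lt_div_of_pos_right hab hs0)
    (by rw [div_pow, div_pow]; field_simp; exact hs2)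
  rw [div_pow, div_pow, Real.log_div (by positivity) (by positivity),
    Real.log_div (by positivity) (by positivity)] at this
  rw [hs2]
  have h2 := mul_le_mul_of_nonneg_left this (by positivity : 0 ≤ s ^ 2)
  have e1 : s ^ 2 * (p * (a ^ 2 / s ^ 2 * (Real.log (a ^ 2) - Real.log (s ^ 2)))
      + (1 - p) * (b ^ 2 / s ^ 2 * (Real.log (b ^ 2) - Real.log (s ^ 2))))
      = p * (a ^ 2 * Real.log (a ^ 2)) + (1 - p) * (b ^ 2 * Real.log (b ^ 2))
        - (p * a ^ 2 + (1 - p) * b ^ 2) * Real.log (s ^ 2) := by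
    field_simp; ring
  have e2 : s ^ 2 * (cLS p * (p * (1 - p) * (a / s - b / s) ^ 2))
      = cLS p * (p * (1 - p) * (a - b) ^ 2) := by
    field_simp
  rw [e1, e2, hs2] at h2
  exact h2

lemma aux_two_lt {p a b : ℝ} (hp : p ∈ Set.Ioo (0 : ℝ) 1) (hb : 0 ≤ b) (hab : b < a) :
    p * (a ^ 2 * Real.log (a ^ 2)) + (1 - p) * (b ^ 2 * Real.log (b ^ 2))
      - (p * a ^ 2 + (1 - p) * b ^ 2) * Real.log (p * a ^ 2 + (1 - p) * b ^ 2)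
      ≤ cLS p * (p * (1 - p) * (a - b) ^ 2) := by
  rcases hb.lt_or_eq with hb | hb
  · exact aux_two_pos hp hb hab
  · subst hb
    have c0 := Real.continuous_mul_log
    have c1 : Continuous fun b : ℝ => p * (a ^ 2 * Real.log (a ^ 2))
        + (1 - p) * (b ^ 2 * Real.log (b ^ 2))
        - (p * a ^ 2 + (1 - p) * b ^ 2) * Real.log (p * a ^ 2 + (1 - p) * b ^ 2) := by
      have c2 : Continuous fun b : ℝ => b ^ 2 * Real.log (b ^ 2) := c0.comp (continuous_pow 2)
      have c3 : Continuous fun b : ℝ => (p * a ^ 2 + (1 - p) * b ^ 2)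
          * Real.log (p * a ^ 2 + (1 - p) * b ^ 2) :=
        c0.comp (by fun_prop : Continuous fun b : ℝ => p * a ^ 2 + (1 - p) * b ^ 2)
      exact ((c2.const_mul _).const_add _).sub c3
    have c4 : Continuous fun b : ℝ => cLS p * (p * (1 - p) * (a - b) ^ 2) := by fun_prop
    refine le_of_tendsto_of_tendsto ((c1.tendsto 0).mono_left (nhdsWithin_le_nhds (s := Set.Ioi 0)))
      ((c4.tendsto 0).mono_left (nhdsWithin_le_nhds (s := Set.Ioi 0))) ?_
    filter_upwards [Ioo_mem_nhdsGT hab] with b hb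
    exact aux_two_pos hp hb.1 hb.2

lemma aux_two {p a b : ℝ} (hp : p ∈ Set.Ioo (0 : ℝ) 1) (ha : 0 ≤ a) (hb : 0 ≤ b) :
    p * (a ^ 2 * Real.log (a ^ 2)) + (1 - p) * (b ^ 2 * Real.log (b ^ 2))
      - (p * a ^ 2 + (1 - p) * b ^ 2) * Real.log (p * a ^ 2 + (1 - p) * b ^ 2)
      ≤ cLS p * (p * (1 - p) * (a - b) ^ 2) := by
  rcases lt_trichotomy b a with h | h | h
  · exact aux_two_lt hp hb h
  · subst h
    have : p * b ^ 2 + (1 - p) * b ^ 2 = b ^ 2 := by ring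
    rw [this]
    apply le_of_eq; ring
  · have hp' : 1 - p ∈ Set.Ioo (0 : ℝ) 1 := ⟨by linarith [hp.2], by linarith [hp.1]⟩
    have := aux_two_lt hp' ha h
    rw [aux_cLS_symm, sub_sub_cancel, add_comm ((1 - p) * b ^ 2)] at this
    linarith [this, sq_nonneg (a - b), (by ring : cLS p * (p * (1 - p) * (a - b) ^ 2)
      = cLS p * ((1 - p) * p * (b - a) ^ 2))]

/-! ### Tensorization -/

lemma aux_lsi (n : ℕ) {p : ℝ} (hp : p ∈ Set.Ioo (0 : ℝ) 1) (g : (Fin n → Bool) → ℝ) :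
    ent n p (fun x => g x ^ 2) ≤ cLS p * ∑ i, muE n p (fun x => del n p i g x ^ 2) := by
  induction n with
  | zero =>
    unfold ent
    rw [aux_muE_zero p _ default, aux_muE_zero p _ default]
    simp
  | succ n ih =>
    have hc := aux_cLS_pos hp
    have h0 := hp.1
    have hq : 0 < 1 - p := by linarith [hp.2]
    have i1 := ih (fun x => g (Fin.cons true x))
    have i0 := ih (fun x => g (Fin.cons false x))
    have n1 : 0 ≤ muE n p (fun x => g (Fin.cons true x) ^ 2) :=
      aux_muE_nonneg n hp fun x => sq_nonneg _
    have n0 : 0 ≤ muE n p (fun x => g (Fin.cons false x) ^ 2) :=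
      aux_muE_nonneg n hp fun x => sq_nonneg _
    have two := aux_two hp (Real.sqrt_nonneg (muE n p (fun x => g (Fin.cons true x) ^ 2)))
      (Real.sqrt_nonneg (muE n p (fun x => g (Fin.cons false x) ^ 2)))
    have mink := aux_minkowski n hp (fun x => g (Fin.cons true x)) (fun x => g (Fin.cons false x))
    rw [Real.sq_sqrt n1, Real.sq_sqrt n0] at two
    have mink2 := mul_le_mul_of_nonneg_left mink (by positivity : 0 ≤ cLS p * (p * (1 - p)))
    have hz : muE (n + 1) p (fun x => del (n + 1) p 0 g x ^ 2)
        = p * (1 - p) * muE n p (fun x => (g (Fin.cons true x) - g (Fin.cons false x)) ^ 2) := by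
      rw [aux_muE_succ]
      simp only [aux_del_zero]
      have e1 : ∀ x : Fin n → Bool, (g (Fin.cons true x) - (p * g (Fin.cons true x)
          + (1 - p) * g (Fin.cons false x))) ^ 2
          = (1 - p) ^ 2 * (g (Fin.cons true x) - g (Fin.cons false x)) ^ 2 := fun x => by ring
      have e0 : ∀ x : Fin n → Bool, (g (Fin.cons false x) - (p * g (Fin.cons true x)
          + (1 - p) * g (Fin.cons false x))) ^ 2
          = p ^ 2 * (g (Fin.cons true x) - g (Fin.cons false x)) ^ 2 := fun x => by ring
      simp only [e1, e0, aux_muE_smul]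
      ring
    rw [Fin.sum_univ_succ, hz]
    have hs : ∑ i : Fin n, muE (n + 1) p (fun x => del (n + 1) p i.succ g x ^ 2)
        = p * (∑ i, muE n p (fun x => del n p i (fun y => g (Fin.cons true y)) x ^ 2))
        + (1 - p) * ∑ i, muE n p (fun x => del n p i (fun y => g (Fin.cons false y)) x ^ 2) := by
      rw [Finset.mul_sum, Finset.mul_sum, ← Finset.sum_add_distrib]
      refine Finset.sum_congr rfl fun i _ => ?_
      rw [aux_muE_succ]
      simp only [aux_del_succ]
    rw [hs]
    have j1 := mul_le_mul_of_nonneg_left i1 h0.le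
    have j0 := mul_le_mul_of_nonneg_left i0 hq.le
    unfold ent at j1 j0 ⊢
    rw [aux_muE_succ, aux_muE_succ]
    linarith

/-- Linearized lower bound on the entropy of a square. -/
lemma aux_ent_lower (n : ℕ) {p : ℝ} (hp : p ∈ Set.Ioo (0 : ℝ) 1) (g : (Fin n → Bool) → ℝ)
    {l : ℝ} (hl : 0 < l) :
    muE n p (fun x => g x ^ 2) * (Real.log l + 1) - l * muE n p (fun x => |g x|) ^ 2
      ≤ ent n p (fun x => g x ^ 2) := by
  have hv : 0 ≤ muE n p (fun x => g x ^ 2) := aux_muE_nonneg n hp fun x => sq_nonneg _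
  rcases hv.lt_or_eq with hv | hv
  · obtain ⟨v, hve⟩ : ∃ v, v = muE n p (fun x => g x ^ 2) := ⟨_, rfl⟩
    obtain ⟨m, hm⟩ : ∃ m, m = √(l * v) := ⟨_, rfl⟩
    have hv0 : 0 < v := by rw [hve]; exact hv
    have hm0 : 0 < m := by rw [hm]; positivity
    have hm2 : m ^ 2 = l * v := by rw [hm, Real.sq_sqrt (by positivity)]
    have hlm : 2 * Real.log m = Real.log l + Real.log v := by
      rw [← Real.log_mul hl.ne' hv0.ne', ← hm2, Real.log_pow]; norm_num
    have hpt : ∀ x, (2 * Real.log m + 2) * g x ^ 2 + (-(2 * m)) * |g x|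
        ≤ g x ^ 2 * Real.log (g x ^ 2) := by
      intro x
      by_cases hx : g x = 0
      · simp [hx]
      · have ha : 0 < |g x| := abs_pos.2 hx
        have h1 := Real.log_le_sub_one_of_pos (div_pos hm0 ha)
        rw [Real.log_div hm0.ne' ha.ne'] at h1
        have h2 : Real.log (g x ^ 2) = 2 * Real.log |g x| := by
          rw [← sq_abs, Real.log_pow]; norm_num
        rw [h2, ← sq_abs]
        generalize |g x| = y at *
        have h3 := mul_le_mul_of_nonneg_left h1 (by positivity : 0 ≤ y ^ 2)
        have h4 : y ^ 2 * (m / y - 1) = m * y - y ^ 2 := by field_simp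
        rw [h4] at h3
        linarith
    have h5 := aux_muE_mono n hp hpt
    rw [aux_muE_add, aux_muE_smul, aux_muE_smul] at h5
    unfold ent
    rw [← hve] at h5 ⊢
    generalize muE n p (fun x => |g x|) = w at *
    have h6 : 2 * m * w * v ≤ (v + l * w ^ 2) * v := by
      nlinarith [sq_nonneg (v - m * w)]
    have h7 : 2 * m * w ≤ v + l * w ^ 2 := le_of_mul_le_mul_right h6 hv0
    have h8 : 2 * Real.log m * v = (Real.log l + Real.log v) * v := by rw [hlm]
    linarith
  · have hz : ∀ x, muW n p x * (g x ^ 2) = 0 := by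
      intro x
      have := (Finset.sum_eq_zero_iff_of_nonneg (fun x _ =>
        mul_nonneg (aux_muW_nonneg n hp x) (sq_nonneg (g x)))).1 hv.symm
      exact this x (Finset.mem_univ x)
    unfold ent
    rw [← hv]
    have : muE n p (fun x => g x ^ 2 * Real.log (g x ^ 2)) = 0 := by
      unfold muE
      refine Finset.sum_eq_zero fun x _ => ?_
      rw [← mul_assoc, hz, zero_mul]
    rw [this]
    have := mul_nonneg hl.le (sq_nonneg (muE n p (fun x => |g x|)))
    linarith

/-- Falik–Samorodnitsky / Rossignol inequality, linearized. -/
lemma aux_main (n : ℕ) {p : ℝ} (hp : p ∈ Set.Ioo (0 : ℝ) 1) (f : (Fin n → Bool) → ℝ)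
    {l : ℝ} (hl : 0 < l) :
    varE n p f * (Real.log l + 1) - l * ∑ j, muE n p (fun x => |del n p j f x|) ^ 2
      ≤ cLS p * ∑ i, muE n p (fun x => del n p i f x ^ 2) := by
  induction n with
  | zero =>
    unfold varE
    rw [aux_muE_zero p _ default, aux_muE_zero p _ default]
    simp
  | succ n ih =>
    have hc := aux_cLS_pos hp
    have h0 := hp.1
    have hq : 0 < 1 - p := by linarith [hp.2]
    have hbar := ih (fun x => p * f (Fin.cons true x) + (1 - p) * f (Fin.cons false x))
    have hE := aux_ent_lower (n + 1) hp (fun x => del (n + 1) p 0 f x) hl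
    have hL := aux_lsi (n + 1) hp (fun x => del (n + 1) p 0 f x)
    -- variance decomposition
    have hV : varE (n + 1) p f = muE (n + 1) p (fun x => del (n + 1) p 0 f x ^ 2)
        + varE n p (fun x => p * f (Fin.cons true x) + (1 - p) * f (Fin.cons false x)) := by
      unfold varE
      rw [aux_muE_succ, aux_muE_succ, aux_muE_succ, aux_muE_add, aux_muE_smul, aux_muE_smul]
      simp only [aux_del_zero]
      have : p * muE n p (fun x => f (Fin.cons true x) ^ 2)
          + (1 - p) * muE n p (fun x => f (Fin.cons false x) ^ 2)
          = p * muE n p (fun x => (f (Fin.cons true x) - (p * f (Fin.cons true x)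
              + (1 - p) * f (Fin.cons false x))) ^ 2)
            + (1 - p) * muE n p (fun x => (f (Fin.cons false x) - (p * f (Fin.cons true x)
              + (1 - p) * f (Fin.cons false x))) ^ 2)
            + muE n p (fun x => (p * f (Fin.cons true x) + (1 - p) * f (Fin.cons false x)) ^ 2) := by
        simp only [← aux_muE_smul, ← aux_muE_add]
        congr 1
        funext x
        ring
      linarith
    -- L1 norms
    have hW : ∑ j, muE n p (fun x => |del n p j
        (fun x => p * f (Fin.cons true x) + (1 - p) * f (Fin.cons false x)) x|) ^ 2
        ≤ ∑ j : Fin n, muE (n + 1) p (fun x => |del (n + 1) p j.succ f x|) ^ 2 := by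
      refine Finset.sum_le_sum fun j _ => ?_
      refine pow_le_pow_left₀ (aux_muE_nonneg n hp fun x => abs_nonneg _) ?_ 2
      rw [aux_muE_succ]
      simp only [aux_del_succ]
      rw [← aux_muE_smul, ← aux_muE_smul, ← aux_muE_add]
      refine aux_muE_mono n hp fun x => ?_
      have : del n p j (fun x => p * f (Fin.cons true x) + (1 - p) * f (Fin.cons false x)) x
          = p * del n p j (fun y => f (Fin.cons true y)) x
            + (1 - p) * del n p j (fun y => f (Fin.cons false y)) x := by
        unfold del; ring
      rw [this]
      refine (abs_add_le _ _).trans ?_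
      rw [abs_mul, abs_mul, abs_of_pos h0, abs_of_pos hq]
    -- energies
    have hD0 : muE (n + 1) p (fun x => del (n + 1) p 0 (fun x => del (n + 1) p 0 f x) x ^ 2)
        = muE (n + 1) p (fun x => del (n + 1) p 0 f x ^ 2) := by
      rw [aux_muE_succ, aux_muE_succ]
      simp only [aux_del_zero]
      congr 2 <;>
      · congr 1
        funext x
        ring
    have hDs : ∀ i : Fin n, muE (n + 1) p (fun x => del (n + 1) p i.succ f x ^ 2)
        = muE (n + 1) p (fun x => del (n + 1) p i.succ (fun x => del (n + 1) p 0 f x) x ^ 2)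
          + muE n p (fun x => del n p i
            (fun x => p * f (Fin.cons true x) + (1 - p) * f (Fin.cons false x)) x ^ 2) := by
      intro i
      rw [aux_muE_succ, aux_muE_succ]
      simp only [aux_del_succ, aux_del_zero]
      simp only [← aux_muE_smul, ← aux_muE_add]
      congr 1
      funext x
      unfold del
      ring
    rw [Fin.sum_univ_succ, hD0] at hL
    rw [Fin.sum_univ_succ, Fin.sum_univ_succ, Finset.sum_congr rfl (fun i _ => hDs i),
      Finset.sum_add_distrib, hV]
    have hW' := mul_le_mul_of_nonneg_left hW hl.le
    linarith

lemma aux_bool (n : ℕ) {p : ℝ} (hp : p ∈ Set.Ioo (0 : ℝ) 1) (f : (Fin n → Bool) → ℝ)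
    (hbool : ∀ x, f x = 0 ∨ f x = 1) (j : Fin n) :
    muE n p (fun x => |del n p j f x|) = 2 * muE n p (fun x => del n p j f x ^ 2) := by
  induction n with
  | zero => exact j.elim0
  | succ n ih =>
    have h0 := hp.1
    have hq : 0 < 1 - p := by linarith [hp.2]
    rw [aux_muE_succ, aux_muE_succ]
    refine Fin.cases ?_ (fun j => ?_) j
    · simp only [aux_del_zero]
      simp only [← aux_muE_smul, ← aux_muE_add]
      congr 1
      funext x
      rcases hbool (Fin.cons true x) with h | h <;> rcases hbool (Fin.cons false x) with h' | h' <;>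
        rw [h, h']
      · simp
      · rw [show (0 : ℝ) - (p * 0 + (1 - p) * 1) = -(1 - p) by ring,
          show (1 : ℝ) - (p * 0 + (1 - p) * 1) = p by ring, abs_neg, abs_of_pos h0, abs_of_pos hq]
        ring
      · rw [show (0 : ℝ) - (p * 1 + (1 - p) * 0) = -p by ring,
          show (1 : ℝ) - (p * 1 + (1 - p) * 0) = 1 - p by ring, abs_neg, abs_of_pos h0,
          abs_of_pos hq]
        ring
      · simp
    · simp only [aux_del_succ]
      rw [ih _ (fun x => hbool _), ih _ (fun x => hbool _)]
      ring

/-- The purely numerical final step. -/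
lemma aux_num {n : ℕ} (hn : 2 ≤ n) {c V D : ℝ} (hc : 0 < c) (hV : 0 < V) (hV4 : V ≤ 1 / 4)
    (hD : 0 < D) (h : V * Real.log (V / (4 * n * D ^ 2)) ≤ c * (n * D)) :
    D ≥ V / (n * c) * min (Real.log ((n : ℝ) / Real.log n ^ 2))
          (Real.log ((n : ℝ) * c ^ (3 + 4 / Real.exp 1) /
            (Real.exp 1 ^ (2 + 4 / Real.exp 1) * V *
              Real.log ((n : ℝ) / Real.log n ^ 2) ^ (3 + 4 / Real.exp 1)))) := by
  have hn0 : (0 : ℝ) < n := by positivity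
  have hn2 : (2 : ℝ) ≤ n := by exact_mod_cast hn
  have hln : (1 : ℝ) / 2 < Real.log n := by
    have := Real.log_le_log (by norm_num) hn2
    linarith [Real.log_two_gt_d9]
  by_contra hcon
  push Not at hcon
  obtain ⟨L, hLe⟩ : ∃ L, L = Real.log ((n : ℝ) / Real.log n ^ 2) := ⟨_, rfl⟩
  rw [← hLe] at hcon
  obtain ⟨M, hMe⟩ : ∃ M, M = Real.log ((n : ℝ) * c ^ (3 + 4 / Real.exp 1) /
            (Real.exp 1 ^ (2 + 4 / Real.exp 1) * V * L ^ (3 + 4 / Real.exp 1))) := ⟨_, rfl⟩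
  rw [← hMe] at hcon
  have hk : 0 < V / (n * c) := by positivity
  have hmin : 0 < min L M := (mul_pos_iff_of_pos_left hk).1 (hD.trans hcon)
  have hL : 0 < L := hmin.trans_le (min_le_left _ _)
  have hDL : D < V / (n * c) * L :=
    hcon.trans_le (mul_le_mul_of_nonneg_left (min_le_left _ _) hk.le)
  have hDL2 : D ^ 2 < (V / (n * c) * L) ^ 2 := pow_lt_pow_left₀ hDL hD.le (by norm_num)
  have hK1 : (n : ℝ) * c ^ 2 / (4 * V * L ^ 2) < V / (4 * n * D ^ 2) := by
    have : (n : ℝ) * c ^ 2 / (4 * V * L ^ 2) = V / (4 * n * (V / (n * c) * L) ^ 2) := by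
      field_simp
    rw [this]
    exact div_lt_div_of_pos_left hV (by positivity) (by nlinarith)
  have hK2 : Real.log (V / (4 * n * D ^ 2)) < min L M := by
    have h1 : c * (n * D) < V * min L M := by
      have h2 := mul_lt_mul_of_pos_left hcon (by positivity : 0 < c * n)
      have h3 : c * n * (V / (n * c) * min L M) = V * min L M := by field_simp
      linarith
    exact lt_of_mul_lt_mul_left (h.trans_lt h1) hV.le
  have hK : Real.log ((n : ℝ) * c ^ 2 / (4 * V * L ^ 2)) < min L M :=
    (Real.log_lt_log (by positivity) hK1).trans hK2
  by_cases hcL : c ≤ 2 * L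
  · have h1 : M ≤ Real.log ((n : ℝ) * c ^ 2 / (4 * V * L ^ 2)) := by
      rw [hMe]
      refine Real.log_le_log (by positivity) ?_
      have he : (1 : ℝ) ≤ 4 / Real.exp 1 := by
        rw [le_div_iff₀ (Real.exp_pos 1)]; linarith [Real.exp_one_lt_d9]
      generalize 4 / Real.exp 1 = r at *
      have a1 : c ^ (3 + r) = c ^ 2 * c ^ (1 + r) := by
        rw [← Real.rpow_natCast, ← Real.rpow_add hc]; congr 1; push_cast; ring
      have a2 : L ^ (3 + r) = L ^ 2 * L ^ (1 + r) := by
        rw [← Real.rpow_natCast, ← Real.rpow_add hL]; congr 1; push_cast; ring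
      have a3 : Real.exp 1 ^ (2 + r) = Real.exp 1 ^ 3 * Real.exp 1 ^ (r - 1) := by
        rw [← Real.rpow_natCast, ← Real.rpow_add (Real.exp_pos 1)]; congr 1; push_cast; ring
      have a4 : c ^ (1 + r) ≤ 4 * (2 : ℝ) ^ (r - 1) * L ^ (1 + r) := by
        have b1 : c ^ (1 + r) ≤ (2 * L) ^ (1 + r) :=
          Real.rpow_le_rpow hc.le hcL (by linarith)
        rw [Real.mul_rpow (by norm_num) hL.le] at b1
        have b2 : (2 : ℝ) ^ (1 + r) = 4 * 2 ^ (r - 1) := by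
          rw [show 1 + r = 2 + (r - 1) by ring, Real.rpow_add (by norm_num)]
          norm_num
        rwa [b2] at b1
      have a5 : (2 : ℝ) ^ (r - 1) ≤ Real.exp 1 ^ (r - 1) :=
        Real.rpow_le_rpow (by norm_num) (by linarith [Real.exp_one_gt_d9]) (by linarith)
      have a6 : (16 : ℝ) ≤ Real.exp 1 ^ 3 := by
        have : (2.7 : ℝ) ^ 3 ≤ Real.exp 1 ^ 3 :=
          pow_le_pow_left₀ (by norm_num) (by linarith [Real.exp_one_gt_d9]) 3
        norm_num at this ⊢
        linarith
      have a7 : 4 * c ^ (1 + r) ≤ Real.exp 1 ^ (2 + r) * L ^ (1 + r) := by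
        rw [a3]
        have hp1 : 0 < L ^ (1 + r) := Real.rpow_pos_of_pos hL _
        have hp2 : 0 < (2 : ℝ) ^ (r - 1) := Real.rpow_pos_of_pos (by norm_num) _
        have b3 : 16 * (2 : ℝ) ^ (r - 1) ≤ Real.exp 1 ^ 3 * Real.exp 1 ^ (r - 1) :=
          mul_le_mul a6 a5 hp2.le (by positivity)
        have b4 := mul_le_mul_of_nonneg_right b3 hp1.le
        linarith
      rw [a1, a2, div_le_div_iff₀ (by positivity) (by positivity)]
      have a8 := mul_le_mul_of_nonneg_left a7 (by positivity : 0 ≤ (n : ℝ) * c ^ 2 * V * L ^ 2)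
      linarith
    exact absurd (hK.trans_le (min_le_right _ _)) (not_lt.2 h1)
  · push Not at hcL
    have h1 : L ≤ Real.log ((n : ℝ) * c ^ 2 / (4 * V * L ^ 2)) := by
      conv_lhs => rw [hLe]
      refine Real.log_le_log (by positivity) ?_
      rw [div_le_div_iff₀ (by positivity) (by positivity)]
      have b1 : (2 * L) ^ 2 ≤ c ^ 2 := pow_le_pow_left₀ (by positivity) hcL.le 2
      have b2 : (1 / 2 : ℝ) ^ 2 ≤ Real.log n ^ 2 := pow_le_pow_left₀ (by positivity) hln.le 2
      have b3 : (2 * L) ^ 2 * (1 / 2) ^ 2 ≤ c ^ 2 * Real.log n ^ 2 :=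
        mul_le_mul b1 b2 (by positivity) (by positivity)
      have b4 : 4 * V * L ^ 2 ≤ 1 * L ^ 2 :=
        mul_le_mul_of_nonneg_right (by linarith) (sq_nonneg L)
      rw [mul_assoc (n : ℝ)]
      refine mul_le_mul_of_nonneg_left ?_ hn0.le
      linarith
    exact absurd (hK.trans_le (min_le_left _ _)) (not_lt.2 h1)

/-- inequality (17): for a nonconstant Boolean function `f` on `{0,1}^n`,
letting `Δ = maxⱼ ∫ (Δⱼ f)² dμ_p`, we have
`Δ ≥ (Var(f)/(n c_LS(p))) · min{ log(n/(log n)²),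
  log( n c_LS(p)^{3+4/e} / (e^{2+4/e} Var(f) (log(n/(log n)²))^{3+4/e}) ) }`. -/
theorem stmt13 (n : ℕ) (hn : 2 ≤ n) (p : ℝ) (hp : p ∈ Set.Ioo (0 : ℝ) 1)
    (f : (Fin n → Bool) → ℝ) (hbool : ∀ x, f x = 0 ∨ f x = 1)
    (hnc : ∃ x y, f x ≠ f y) :
    (⨆ j : Fin n, muE n p (fun x => del n p j f x ^ 2)) ≥
      varE n p f / (n * cLS p) *
        min (Real.log ((n : ℝ) / Real.log n ^ 2))
          (Real.log ((n : ℝ) * cLS p ^ (3 + 4 / Real.exp 1) /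
            (Real.exp 1 ^ (2 + 4 / Real.exp 1) * varE n p f *
              Real.log ((n : ℝ) / Real.log n ^ 2) ^ (3 + 4 / Real.exp 1)))) := by
  have hn0 : (0 : ℝ) < n := by
    have : (2 : ℝ) ≤ n := by exact_mod_cast hn
    linarith
  have hc := aux_cLS_pos hp
  obtain ⟨D, hDe⟩ : ∃ D, D = ⨆ j : Fin n, muE n p (fun x => del n p j f x ^ 2) := ⟨_, rfl⟩
  rw [← hDe]
  have hle : ∀ j, muE n p (fun x => del n p j f x ^ 2) ≤ D := fun j => by
    rw [hDe]
    exact le_ciSup (f := fun j : Fin n => muE n p (fun x => del n p j f x ^ 2))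
      (Set.finite_range _).bddAbove j
  have hnn : ∀ j, 0 ≤ muE n p (fun x => del n p j f x ^ 2) := fun j =>
    aux_muE_nonneg n hp fun x => sq_nonneg _
  have hD0 : 0 ≤ D := (hnn ⟨0, by omega⟩).trans (hle _)
  have hVe : varE n p f = muE n p f - muE n p f ^ 2 := by
    unfold varE
    congr 2
    funext x
    rcases hbool x with h | h <;> rw [h] <;> norm_num
  have hm0 : 0 ≤ muE n p f := aux_muE_nonneg n hp fun x => by
    rcases hbool x with h | h <;> rw [h] <;> norm_num
  have hm1 : muE n p f ≤ 1 := by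
    rw [← aux_muE_one n p]
    exact aux_muE_mono n hp fun x => by
      rcases hbool x with h | h <;> rw [h] <;> norm_num
  have hV0 : 0 ≤ varE n p f := by rw [hVe]; nlinarith
  have hV4 : varE n p f ≤ 1 / 4 := by rw [hVe]; nlinarith [sq_nonneg (muE n p f - 1 / 2)]
  rcases hV0.lt_or_eq with hV | hV
  · have hW : ∑ j, muE n p (fun x => |del n p j f x|) ^ 2 ≤ 4 * n * D ^ 2 := by
      have : ∀ j ∈ Finset.univ, muE n p (fun x => |del n p j f x|) ^ 2 ≤ 4 * D ^ 2 := by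
        intro j _
        rw [aux_bool n hp f hbool j, mul_pow]
        have := pow_le_pow_left₀ (hnn j) (hle j) 2
        linarith
      have := Finset.sum_le_sum this
      simp at this
      linarith
    have hE : ∑ j, muE n p (fun x => del n p j f x ^ 2) ≤ n * D := by
      have := Finset.sum_le_sum (fun j (_ : j ∈ Finset.univ) => hle j)
      simpa using this
    have hE' := mul_le_mul_of_nonneg_left hE hc.le
    rcases hD0.lt_or_eq with hD | hD
    · refine aux_num hn hc hV hV4 hD ?_
      have hl : 0 < varE n p f / (4 * n * D ^ 2) := by positivity
      have hmain := aux_main n hp f hl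
      have hW' := mul_le_mul_of_nonneg_left hW hl.le
      have : varE n p f / (4 * n * D ^ 2) * (4 * n * D ^ 2) = varE n p f := by field_simp
      linarith
    · exfalso
      have hmain := aux_main n hp f one_pos
      rw [← hD] at hW hE'
      simp only [Real.log_one] at hmain
      linarith
  · rw [← hV]
    simpa using hD0
end

section
/- For every integer n ≥ 2, every p ∈ (0,1), and every Boolean function f : {0,1}^n → {0,1}, the largest influence of a variable on f satisfies max{ I_j(f) : j = 1,…,n } ≥ Var_{μ_{n,p}}(f) · s(n) / ( n · p(1−p) · c_LS(p) ). -/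
open Finset

/-! ### The two-point logarithmic Sobolev inequality -/

theorem mvt_pos (F F' : ℝ → ℝ) (hF : ∀ r, 0 < r → HasDerivAt F (F' r) r)
    (a b : ℝ) (ha : 0 < a) (hab : a < b) (h : F a < F b) :
    ∃ ξ, a < ξ ∧ ξ < b ∧ 0 < F' ξ := by
  obtain ⟨ξ, hξ, he⟩ := exists_hasDerivAt_eq_slope F F' hab
    (fun x hx => (hF x (lt_of_lt_of_le ha hx.1)).continuousAt.continuousWithinAt)
    (fun x hx => hF x (ha.trans hx.1))
  refine ⟨ξ, hξ.1, hξ.2, ?_⟩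
  rw [he]
  exact div_pos (by linarith) (by linarith)

theorem mvt_neg (F F' : ℝ → ℝ) (hF : ∀ r, 0 < r → HasDerivAt F (F' r) r)
    (a b : ℝ) (ha : 0 < a) (hab : a < b) (h : F b < F a) :
    ∃ ξ, a < ξ ∧ ξ < b ∧ F' ξ < 0 := by
  obtain ⟨ξ, h1, h2, h3⟩ := mvt_pos (fun x => - F x) (fun x => - F' x)
    (fun r hr => (hF r hr).neg) a b ha hab (by simpa using h)
  exact ⟨ξ, h1, h2, by linarith⟩

noncomputable def tpG (p c r : ℝ) : ℝ :=
  c * p * (1 - p) * (r - 1) ^ 2 -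
    (p * r ^ 2 * (2 * Real.log r) - (p * r ^ 2 + (1 - p)) * Real.log (p * r ^ 2 + (1 - p)))

noncomputable def tpH (p c r : ℝ) : ℝ :=
  c * (1 - p) * (1 - r⁻¹) - (2 * Real.log r - Real.log (p * r ^ 2 + (1 - p)))

theorem tpG_deriv (p c : ℝ) (hp : 0 < p) (hp1 : p < 1) (r : ℝ) (hr : 0 < r) :
    HasDerivAt (tpG p c) (2 * p * r * tpH p c r) r := by
  have hD : 0 < p * r ^ 2 + (1 - p) := by have := mul_pos hp (pow_pos hr 2); linarith
  have h1 : HasDerivAt (fun r : ℝ => p * r ^ 2) (p * (2 * r)) r := by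
    simpa using (hasDerivAt_pow 2 r).const_mul p
  have h2 : HasDerivAt (fun r : ℝ => p * r ^ 2 + (1 - p)) (p * (2 * r)) r := h1.add_const _
  have h3 := h2.log hD.ne'
  have h4 : HasDerivAt (fun r : ℝ => 2 * Real.log r) (2 * r⁻¹) r :=
    (Real.hasDerivAt_log hr.ne').const_mul 2
  have h5 : HasDerivAt (fun r : ℝ => c * p * (1 - p) * (r - 1) ^ 2)
      (c * p * (1 - p) * (2 * (r - 1))) r := by
    simpa using (((hasDerivAt_id r).sub_const 1).pow 2).const_mul (c * p * (1 - p))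
  have h6 := h5.sub ((h1.mul h4).sub (h2.mul h3))
  refine h6.congr_deriv ?_
  unfold tpH
  field_simp
  ring

theorem tpH_deriv (p c : ℝ) (hp : 0 < p) (hp1 : p < 1) (r : ℝ) (hr : 0 < r) :
    HasDerivAt (tpH p c)
      ((1 - p) / (r ^ 2 * (p * r ^ 2 + (1 - p))) * (c * (p * r ^ 2 + (1 - p)) - 2 * r)) r := by
  have hD : 0 < p * r ^ 2 + (1 - p) := by have := mul_pos hp (pow_pos hr 2); linarith
  have h1 : HasDerivAt (fun r : ℝ => p * r ^ 2) (p * (2 * r)) r := by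
    simpa using (hasDerivAt_pow 2 r).const_mul p
  have h2 : HasDerivAt (fun r : ℝ => p * r ^ 2 + (1 - p)) (p * (2 * r)) r := h1.add_const _
  have h3 := h2.log hD.ne'
  have h4 : HasDerivAt (fun r : ℝ => 2 * Real.log r) (2 * r⁻¹) r :=
    (Real.hasDerivAt_log hr.ne').const_mul 2
  have h5 : HasDerivAt (fun r : ℝ => c * (1 - p) * (1 - r⁻¹))
      (c * (1 - p) * (- (-(r ^ 2)⁻¹))) r :=
    ((hasDerivAt_inv hr.ne').const_sub 1).const_mul _
  have h6 := h5.sub (h4.sub h3)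
  refine h6.congr_deriv ?_
  field_simp
  ring

theorem tpG_nonneg (p c : ℝ) (hp : 0 < p) (hp2 : p ≤ 1 / 2) (hc : 2 ≤ c)
    (hcl : c * (1 - 2 * p) = Real.log (1 - p) - Real.log p) (x : ℝ) (hx : 0 < x) :
    0 ≤ tpG p c x := by
  have hp1 : p < 1 := by linarith
  have hq : 0 < 1 - p := by linarith
  set R := (1 - p) / p with hR
  have hRp : R * p = 1 - p := by rw [hR]; field_simp
  have hR0 : 0 < R := div_pos hq hp
  have hR1 : 1 ≤ R := by rw [hR, le_div_iff₀ hp]; linarith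
  have hlogR : Real.log R = c * (1 - 2 * p) := by
    rw [hcl, hR, Real.log_div hq.ne' hp.ne']
  have hRR : p * R ^ 2 + (1 - p) = R := by
    rw [← hRp]
    have : p * R ^ 2 + R * p = R * (R * p + p) := by ring
    rw [this, hRp]; ring
  have G1 : tpG p c 1 = 0 := by simp [tpG]
  have H1 : tpH p c 1 = 0 := by simp [tpH]
  have GR : tpG p c R = 0 := by
    unfold tpG
    rw [hRR, hlogR, hR]; field_simp; ring
  have HR : tpH p c R = 0 := by
    unfold tpH
    rw [hRR, hlogR, hR]; field_simp; ring
  have dG := tpG_deriv p c hp hp1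
  have dH := tpH_deriv p c hp hp1
  have sG : ∀ r, 0 < r → 0 < 2 * p * r * tpH p c r → 0 < tpH p c r := fun r hr h =>
    (mul_pos_iff_of_pos_left (by positivity)).1 h
  have sG' : ∀ r, 0 < r → 2 * p * r * tpH p c r < 0 → tpH p c r < 0 := fun r hr h => by
    by_contra hh
    push Not at hh
    have : 0 ≤ 2 * p * r * tpH p c r := by positivity
    linarith
  have kpos : ∀ r : ℝ, 0 < r → 0 < (1 - p) / (r ^ 2 * (p * r ^ 2 + (1 - p))) := fun r hr => by
    positivity
  have sH : ∀ r, 0 < r → 0 < (1 - p) / (r ^ 2 * (p * r ^ 2 + (1 - p))) *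
      (c * (p * r ^ 2 + (1 - p)) - 2 * r) → 0 < c * (p * r ^ 2 + (1 - p)) - 2 * r :=
    fun r hr h => (mul_pos_iff_of_pos_left (kpos r hr)).1 h
  have sH' : ∀ r, 0 < r → (1 - p) / (r ^ 2 * (p * r ^ 2 + (1 - p))) *
      (c * (p * r ^ 2 + (1 - p)) - 2 * r) < 0 → c * (p * r ^ 2 + (1 - p)) - 2 * r < 0 :=
    fun r hr h => by
      by_contra hh
      push Not at hh
      have := mul_nonneg (kpos r hr).le hh
      linarith
  have Qlow : ∀ r : ℝ, 2 * ((r - 1) * (p * r - (1 - p))) ≤ c * (p * r ^ 2 + (1 - p)) - 2 * r := by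
    intro r
    have h1 : 0 ≤ p * r ^ 2 + (1 - p) := by positivity
    nlinarith
  by_contra hneg
  push Not at hneg
  rcases lt_trichotomy x 1 with h | h | h
  · obtain ⟨ξ, a1, a2, a3⟩ := mvt_pos _ _ dG x 1 hx h (by rw [G1]; exact hneg)
    have hξ : 0 < ξ := by linarith
    obtain ⟨η, b1, b2, b3⟩ := mvt_neg _ _ dH ξ 1 hξ a2 (by rw [H1]; exact sG ξ hξ a3)
    have hη : 0 < η := by linarith
    have h4 := sH' η hη b3
    have h5 := Qlow η
    have h6 : 0 ≤ (1 - η) * ((1 - p) - p * η) := mul_nonneg (by linarith) (by nlinarith)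
    nlinarith
  · rw [h, G1] at hneg; exact lt_irrefl _ hneg
  · rcases lt_trichotomy x R with h' | h' | h'
    · obtain ⟨ξ1, a1, a2, a3⟩ := mvt_neg _ _ dG 1 x one_pos h (by rw [G1]; exact hneg)
      have hξ1 : 0 < ξ1 := by linarith
      obtain ⟨ξ2, b1, b2, b3⟩ := mvt_pos _ _ dG x R hx h' (by rw [GR]; exact hneg)
      have hξ2 : 0 < ξ2 := by linarith
      have n1 := sG' _ hξ1 a3
      have n2 := sG _ hξ2 b3
      obtain ⟨η1, c1, c2, c3⟩ := mvt_neg _ _ dH 1 ξ1 one_pos a1 (by rw [H1]; exact n1)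
      obtain ⟨η2, d1, d2, d3⟩ := mvt_pos _ _ dH ξ1 ξ2 hξ1 (by linarith) (by linarith)
      obtain ⟨η3, e1, e2, e3⟩ := mvt_neg _ _ dH ξ2 R hξ2 b2 (by rw [HR]; exact n2)
      have q1 := sH' η1 (by linarith) c3
      have q2 := sH η2 (by linarith) d3
      have q3 := sH' η3 (by linarith) e3
      have k1 : 0 < η2 - η1 := by linarith
      have k2 : 0 < η3 - η2 := by linarith
      have hcp : 0 < c * p := by positivity
      have m1 := mul_pos k2 (neg_pos.2 q1)
      have m2 := mul_pos k1 (neg_pos.2 q3)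
      have m3 := mul_pos (add_pos k1 k2) q2
      have m4 := mul_pos hcp (mul_pos (mul_pos k1 k2) (add_pos k1 k2))
      have key : (η3 - η2) * -(c * (p * η1 ^ 2 + (1 - p)) - 2 * η1) +
          (η2 - η1) * -(c * (p * η3 ^ 2 + (1 - p)) - 2 * η3) +
          (η2 - η1 + (η3 - η2)) * (c * (p * η2 ^ 2 + (1 - p)) - 2 * η2) +
          c * p * ((η2 - η1) * (η3 - η2) * (η2 - η1 + (η3 - η2))) = 0 := by ring
      linarith
    · rw [h', GR] at hneg; exact lt_irrefl _ hneg
    · obtain ⟨ξ, a1, a2, a3⟩ := mvt_neg _ _ dG R x hR0 h' (by rw [GR]; exact hneg)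
      have hξ : 0 < ξ := by linarith
      obtain ⟨η, b1, b2, b3⟩ := mvt_neg _ _ dH R ξ hR0 a1 (by rw [HR]; exact sG' ξ hξ a3)
      have hη : 0 < η := by linarith
      have h4 := sH' η hη b3
      have h5 := Qlow η
      have h6 : 0 ≤ (η - 1) * (p * η - (1 - p)) :=
        mul_nonneg (by linarith) (by rw [← hRp]; nlinarith)
      linarith

/-- two-point inequality, positive values, `p ≤ 1/2` -/
theorem tp_pos (p c : ℝ) (hp : 0 < p) (hp2 : p ≤ 1 / 2) (hc : 2 ≤ c)
    (hcl : c * (1 - 2 * p) = Real.log (1 - p) - Real.log p) (a b : ℝ) (ha : 0 < a) (hb : 0 < b) :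
    p * (a ^ 2 * Real.log (a ^ 2)) + (1 - p) * (b ^ 2 * Real.log (b ^ 2)) -
      (p * a ^ 2 + (1 - p) * b ^ 2) * Real.log (p * a ^ 2 + (1 - p) * b ^ 2)
      ≤ c * (p * (1 - p)) * (a - b) ^ 2 := by
  have h := tpG_nonneg p c hp hp2 hc hcl (a / b) (div_pos ha hb)
  set r := a / b with hr
  have har : a = r * b := by rw [hr]; field_simp
  have hr0 : 0 < r := div_pos ha hb
  have hD : 0 < p * r ^ 2 + (1 - p) := by
    have := mul_pos hp (pow_pos hr0 2); linarith
  have e1 : Real.log (a ^ 2) = 2 * Real.log r + 2 * Real.log b := by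
    rw [har, Real.log_pow, Real.log_mul hr0.ne' hb.ne']; push_cast; ring
  have e2 : Real.log (b ^ 2) = 2 * Real.log b := by rw [Real.log_pow]; push_cast; ring
  have e3 : p * a ^ 2 + (1 - p) * b ^ 2 = (p * r ^ 2 + (1 - p)) * b ^ 2 := by rw [har]; ring
  rw [e3, Real.log_mul hD.ne' (by positivity), e1, e2]
  have := mul_nonneg (sq_nonneg b) h
  unfold tpG at this
  rw [har]
  nlinarith

theorem tp_pos' (p c : ℝ) (hp : 0 < p) (hp1 : p < 1) (hc : 2 ≤ c)
    (hcl : c * (1 - 2 * p) = Real.log (1 - p) - Real.log p) (a b : ℝ) (ha : 0 < a) (hb : 0 < b) :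
    p * (a ^ 2 * Real.log (a ^ 2)) + (1 - p) * (b ^ 2 * Real.log (b ^ 2)) -
      (p * a ^ 2 + (1 - p) * b ^ 2) * Real.log (p * a ^ 2 + (1 - p) * b ^ 2)
      ≤ c * (p * (1 - p)) * (a - b) ^ 2 := by
  rcases le_total p (1 / 2) with h | h
  · exact tp_pos p c hp h hc hcl a b ha hb
  · have := tp_pos (1 - p) c (by linarith) (by linarith) hc
      (by rw [sub_sub_cancel]; linarith) b a hb ha
    rw [sub_sub_cancel, add_comm ((1 - p) * b ^ 2)] at this
    nlinarith

theorem tp_all (p c : ℝ) (hp : 0 < p) (hp1 : p < 1) (hc : 2 ≤ c)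
    (hcl : c * (1 - 2 * p) = Real.log (1 - p) - Real.log p) (a b : ℝ) (ha : 0 ≤ a) (hb : 0 ≤ b) :
    p * (a ^ 2 * Real.log (a ^ 2)) + (1 - p) * (b ^ 2 * Real.log (b ^ 2)) -
      (p * a ^ 2 + (1 - p) * b ^ 2) * Real.log (p * a ^ 2 + (1 - p) * b ^ 2)
      ≤ c * (p * (1 - p)) * (a - b) ^ 2 := by
  have key : ∀ ε ∈ Set.Ioi (0 : ℝ),
    p * ((a + ε) ^ 2 * Real.log ((a + ε) ^ 2)) +
      (1 - p) * ((b + ε) ^ 2 * Real.log ((b + ε) ^ 2)) -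
      (p * (a + ε) ^ 2 + (1 - p) * (b + ε) ^ 2) *
        Real.log (p * (a + ε) ^ 2 + (1 - p) * (b + ε) ^ 2)
      ≤ c * (p * (1 - p)) * ((a + ε) - (b + ε)) ^ 2 := fun ε hε =>
    tp_pos' p c hp hp1 hc hcl _ _ (add_pos_of_nonneg_of_pos ha hε)
      (add_pos_of_nonneg_of_pos hb hε)
  have cml : ∀ g : ℝ → ℝ, Continuous g → Continuous fun ε => g ε * Real.log (g ε) :=
    fun g hg => Real.continuous_mul_log.comp hg
  have c1 := cml (fun ε => (a + ε) ^ 2) (by fun_prop)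
  have c2 := cml (fun ε => (b + ε) ^ 2) (by fun_prop)
  have c3 := cml (fun ε => p * (a + ε) ^ 2 + (1 - p) * (b + ε) ^ 2) (by fun_prop)
  have hL : Continuous fun ε : ℝ => p * ((a + ε) ^ 2 * Real.log ((a + ε) ^ 2)) +
      (1 - p) * ((b + ε) ^ 2 * Real.log ((b + ε) ^ 2)) -
      (p * (a + ε) ^ 2 + (1 - p) * (b + ε) ^ 2) *
        Real.log (p * (a + ε) ^ 2 + (1 - p) * (b + ε) ^ 2) :=
    ((continuous_const.mul c1).add (continuous_const.mul c2)).sub c3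
  have hRc : Continuous fun ε : ℝ => c * (p * (1 - p)) * ((a + ε) - (b + ε)) ^ 2 := by fun_prop
  have hm : (0 : ℝ) ∈ closure (Set.Ioi (0 : ℝ)) := by rw [closure_Ioi]; exact Set.self_mem_Ici
  have := ContinuousWithinAt.closure_le hm hL.continuousAt.continuousWithinAt
    hRc.continuousAt.continuousWithinAt key
  simpa using this

theorem cLS_mul (p : ℝ) : cLS p * (1 - 2 * p) = Real.log (1 - p) - Real.log p := by
  unfold cLS
  split_ifs with h
  · subst h; norm_num
  · have : 1 - 2 * p ≠ 0 := fun h' => h (by linarith)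
    exact div_mul_cancel₀ _ this

theorem two_le_aux (x : ℝ) (hx : 0 < x) (hx1 : x < 1) :
    2 * x ≤ Real.log (1 + x) - Real.log (1 - x) := by
  have h := Real.hasSum_log_sub_log_of_abs_lt_one (abs_lt.2 ⟨by linarith, hx1⟩)
  have h0 := h.summable.le_tsum 0 (fun j _ => by positivity)
  rw [h.tsum_eq] at h0
  simpa using h0

theorem two_le_cLS (p : ℝ) (hp : 0 < p) (hp1 : p < 1) : 2 ≤ cLS p := by
  have h := cLS_mul p
  have aux : ∀ t : ℝ, 0 < t → Real.log (2 * t) = Real.log 2 + Real.log t := fun t ht =>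
    Real.log_mul (by norm_num) ht.ne'
  have a1 := aux p hp
  have a2 := aux (1 - p) (by linarith)
  rcases lt_trichotomy p (1 / 2) with h' | h' | h'
  · have := two_le_aux (1 - 2 * p) (by linarith) (by linarith)
    rw [show 1 + (1 - 2 * p) = 2 * (1 - p) by ring, show 1 - (1 - 2 * p) = 2 * p by ring] at this
    nlinarith
  · simp [cLS, h']
  · have := two_le_aux (2 * p - 1) (by linarith) (by linarith)
    rw [show 1 - (2 * p - 1) = 2 * (1 - p) by ring, show 1 + (2 * p - 1) = 2 * p by ring] at this
    nlinarith

/-! ### Expectations -/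

theorem muW_nonneg (n : ℕ) (p : ℝ) (hp : 0 < p) (hp1 : p < 1) (x : Fin n → Bool) :
    0 ≤ muW n p x := by
  unfold muW
  refine Finset.prod_nonneg fun i _ => ?_
  split_ifs <;> linarith

theorem muE_add (n : ℕ) (p : ℝ) (F G : (Fin n → Bool) → ℝ) :
    muE n p (fun x => F x + G x) = muE n p F + muE n p G := by
  simp only [muE, mul_add, Finset.sum_add_distrib]

theorem muE_mul (n : ℕ) (p k : ℝ) (F : (Fin n → Bool) → ℝ) :
    muE n p (fun x => k * F x) = k * muE n p F := by
  simp only [muE, Finset.mul_sum]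
  exact Finset.sum_congr rfl fun x _ => by ring

theorem muE_sub (n : ℕ) (p : ℝ) (F G : (Fin n → Bool) → ℝ) :
    muE n p (fun x => F x - G x) = muE n p F - muE n p G := by
  simp only [muE, mul_sub, Finset.sum_sub_distrib]

theorem muE_mono (n : ℕ) (p : ℝ) (hp : 0 < p) (hp1 : p < 1) (F G : (Fin n → Bool) → ℝ)
    (h : ∀ x, F x ≤ G x) : muE n p F ≤ muE n p G :=
  Finset.sum_le_sum fun x _ => mul_le_mul_of_nonneg_left (h x) (muW_nonneg n p hp hp1 x)

theorem muE_nonneg (n : ℕ) (p : ℝ) (hp : 0 < p) (hp1 : p < 1) (F : (Fin n → Bool) → ℝ)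
    (h : ∀ x, 0 ≤ F x) : 0 ≤ muE n p F :=
  Finset.sum_nonneg fun x _ => mul_nonneg (muW_nonneg n p hp hp1 x) (h x)

theorem muW_cons (n : ℕ) (p : ℝ) (b : Bool) (y : Fin n → Bool) :
    muW (n + 1) p (Fin.cons b y : Fin (n + 1) → Bool) = (if b then p else 1 - p) * muW n p y := by
  unfold muW
  rw [Fin.prod_univ_succ]
  simp

theorem muE_succ (n : ℕ) (p : ℝ) (F : (Fin (n + 1) → Bool) → ℝ) :
    muE (n + 1) p F = p * muE n p (fun y => F (Fin.cons true y)) +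
      (1 - p) * muE n p (fun y => F (Fin.cons false y)) := by
  unfold muE
  rw [← (Fin.consEquiv (fun _ : Fin (n + 1) => Bool)).sum_comp, Fintype.sum_prod_type,
    Fintype.sum_bool]
  have hc : ∀ (b : Bool) (y : Fin n → Bool),
      (Fin.consEquiv (fun _ : Fin (n + 1) => Bool)) (b, y) = Fin.cons b y := fun _ _ => rfl
  have hw := muW_cons n p
  rw [Finset.mul_sum, Finset.mul_sum]
  congr 1
  · refine Finset.sum_congr rfl fun y _ => ?_
    rw [hc, hw true y, if_pos rfl, mul_assoc]
  · refine Finset.sum_congr rfl fun y _ => ?_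
    rw [hc, hw false y, if_neg (by simp), mul_assoc]

theorem muE_zero (p : ℝ) (F : (Fin 0 → Bool) → ℝ) : muE 0 p F = F default := by
  unfold muE muW
  simp
  exact congrArg F (Subsingleton.elim _ _)

theorem muE_const (n : ℕ) (p k : ℝ) : muE n p (fun _ => k) = k := by
  induction n with
  | zero => exact muE_zero p _
  | succ n ih => rw [muE_succ, ih]; ring

/-- Dirichlet energy -/
noncomputable def enr (n : ℕ) (p : ℝ) (f : (Fin n → Bool) → ℝ) : ℝ :=
  ∑ i : Fin n, muE n p (fun x => (grad n i f x) ^ 2)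

theorem grad_zero_cons (n : ℕ) (f : (Fin (n + 1) → Bool) → ℝ) (b : Bool) (y : Fin n → Bool) :
    grad (n + 1) 0 f (Fin.cons b y) = f (Fin.cons true y) - f (Fin.cons false y) := by
  simp [grad, Fin.update_cons_zero]

theorem grad_succ_cons (n : ℕ) (i : Fin n) (f : (Fin (n + 1) → Bool) → ℝ) (b : Bool)
    (y : Fin n → Bool) :
    grad (n + 1) i.succ f (Fin.cons b y) = grad n i (fun z => f (Fin.cons b z)) y := by
  simp [grad, Fin.cons_update]

theorem enr_succ (n : ℕ) (p : ℝ) (f : (Fin (n + 1) → Bool) → ℝ) :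
    enr (n + 1) p f = muE n p (fun y => (f (Fin.cons true y) - f (Fin.cons false y)) ^ 2) +
      (p * enr n p (fun y => f (Fin.cons true y)) +
        (1 - p) * enr n p (fun y => f (Fin.cons false y))) := by
  unfold enr
  rw [Fin.sum_univ_succ, Finset.mul_sum, Finset.mul_sum, ← Finset.sum_add_distrib]
  simp only [muE_succ, grad_zero_cons, grad_succ_cons]
  ring

theorem cs_sqrt (n : ℕ) (p : ℝ) (hp : 0 < p) (hp1 : p < 1) (u v : (Fin n → Bool) → ℝ) :
    (√(muE n p fun x => u x ^ 2) - √(muE n p fun x => v x ^ 2)) ^ 2 ≤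
      muE n p (fun x => (u x - v x) ^ 2) := by
  have hU := muE_nonneg n p hp hp1 (fun x => u x ^ 2) (fun x => sq_nonneg _)
  have hV := muE_nonneg n p hp hp1 (fun x => v x ^ 2) (fun x => sq_nonneg _)
  have e : muE n p (fun x => (u x - v x) ^ 2) =
      muE n p (fun x => u x ^ 2) + muE n p (fun x => v x ^ 2) -
        2 * muE n p (fun x => u x * v x) := by
    rw [← muE_mul, ← muE_add, ← muE_sub]
    congr 1; funext x; ring
  have hcs : (muE n p fun x => u x * v x) ^ 2 ≤
      (muE n p fun x => u x ^ 2) * (muE n p fun x => v x ^ 2) := by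
    unfold muE
    refine Finset.sum_sq_le_sum_mul_sum_of_sq_le_mul _ ?_ ?_ ?_
    · exact fun x _ => mul_nonneg (muW_nonneg n p hp hp1 x) (sq_nonneg _)
    · exact fun x _ => mul_nonneg (muW_nonneg n p hp hp1 x) (sq_nonneg _)
    · intro x _; exact le_of_eq (by ring)
  have h2 : muE n p (fun x => u x * v x) ≤
      √(muE n p fun x => u x ^ 2) * √(muE n p fun x => v x ^ 2) := by
    rw [← Real.sqrt_mul hU]
    exact Real.le_sqrt_of_sq_le hcs
  rw [e, sub_sq, Real.sq_sqrt hU, Real.sq_sqrt hV]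
  linarith

/-- logarithmic Sobolev inequality on the cube -/
theorem logsob (p c : ℝ) (hp : 0 < p) (hp1 : p < 1) (hc : 2 ≤ c)
    (hcl : c * (1 - 2 * p) = Real.log (1 - p) - Real.log p) (n : ℕ) :
    ∀ g : (Fin n → Bool) → ℝ,
      ent n p (fun x => g x ^ 2) ≤ c * (p * (1 - p)) * enr n p g := by
  induction n with
  | zero => intro g; simp [ent, enr, muE_zero]
  | succ n ih =>
    intro g
    have i1 := ih (fun y => g (Fin.cons true y))
    have i0 := ih (fun y => g (Fin.cons false y))
    rw [enr_succ]
    unfold ent at i1 i0 ⊢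
    simp only [muE_succ]
    have hU := muE_nonneg n p hp hp1 (fun y => g (Fin.cons true y) ^ 2) (fun x => sq_nonneg _)
    have hV := muE_nonneg n p hp hp1 (fun y => g (Fin.cons false y) ^ 2) (fun x => sq_nonneg _)
    have t := tp_all p c hp hp1 hc hcl _ _
      (Real.sqrt_nonneg (muE n p fun y => g (Fin.cons true y) ^ 2))
      (Real.sqrt_nonneg (muE n p fun y => g (Fin.cons false y) ^ 2))
    have s := cs_sqrt n p hp hp1 (fun y => g (Fin.cons true y)) (fun y => g (Fin.cons false y))
    rw [Real.sq_sqrt hU, Real.sq_sqrt hV] at t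
    have hk : 0 ≤ c * (p * (1 - p)) :=
      mul_nonneg (by linarith) (mul_nonneg hp.le (by linarith))
    have s' := mul_le_mul_of_nonneg_left s hk
    have i1' := mul_le_mul_of_nonneg_left i1 hp.le
    have i0' := mul_le_mul_of_nonneg_left i0 (show 0 ≤ 1 - p by linarith)
    simp only [mul_sub] at i1' i0'
    linarith

theorem mul_log_tangent (u s : ℝ) (hu : 0 ≤ u) (hs : 0 < s) :
    u * Real.log s + u - s ≤ u * Real.log u := by
  rcases hu.eq_or_lt with h | h
  · subst h; simp; exact hs.le
  · have h1 := Real.log_le_sub_one_of_pos (div_pos hs h)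
    rw [Real.log_div hs.ne' h.ne'] at h1
    have h2 := mul_le_mul_of_nonneg_left h1 hu
    have h3 : u * (s / u - 1) = s - u := by field_simp
    rw [h3] at h2
    linarith

/-- entropy lower bound -/
theorem ent_lower (n : ℕ) (p : ℝ) (hp : 0 < p) (hp1 : p < 1) (g : (Fin n → Bool) → ℝ)
    (W t : ℝ) (hW : 0 < W) (ht : 0 < t) (hg : muE n p (fun x => |g x|) ≤ W) :
    (Real.log t + 1 - 2 * Real.log W) * muE n p (fun x => g x ^ 2) - t ≤
      ent n p (fun x => g x ^ 2) := by
  set V := muE n p (fun x => g x ^ 2) with hV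
  have hV0 : 0 ≤ V := muE_nonneg n p hp hp1 _ (fun x => sq_nonneg _)
  have key : ∀ s : ℝ, 0 < s → (2 * Real.log s + 2) * V - 2 * s * W ≤
      muE n p (fun x => g x ^ 2 * Real.log (g x ^ 2)) := by
    intro s hs
    have h1 : muE n p (fun x => (2 * Real.log s + 2) * g x ^ 2 - 2 * s * |g x|) ≤
        muE n p (fun x => g x ^ 2 * Real.log (g x ^ 2)) := by
      refine muE_mono n p hp hp1 _ _ fun x => ?_
      have h2 := mul_log_tangent |g x| s (abs_nonneg _) hs
      have h3 := mul_le_mul_of_nonneg_left h2 (abs_nonneg (g x))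
      have h4 : Real.log (g x ^ 2) = 2 * Real.log |g x| := by
        rw [Real.log_pow, Real.log_abs]; push_cast; ring
      rw [h4, ← sq_abs (g x)]
      nlinarith
    rw [muE_sub, muE_mul, muE_mul, ← hV] at h1
    have := mul_le_mul_of_nonneg_left hg (show 0 ≤ 2 * s by linarith)
    linarith
  unfold ent
  rw [← hV]
  rcases hV0.eq_or_lt with h | h
  · rw [← h]
    have := key (t / (2 * W)) (by positivity)
    rw [← h] at this
    have e : 2 * (t / (2 * W)) * W = t := by field_simp
    rw [e] at this
    linarith
  · have h1 := key (V / W) (by positivity)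
    have e : 2 * (V / W) * W = 2 * V := by field_simp
    rw [e, Real.log_div h.ne' hW.ne'] at h1
    have h2 := mul_log_tangent V t h.le ht
    linarith

theorem enr_sub_avg (n : ℕ) (p : ℝ) (f1 f0 : (Fin n → Bool) → ℝ) :
    p * enr n p (fun y => f1 y - (p * f1 y + (1 - p) * f0 y)) +
      (1 - p) * enr n p (fun y => f0 y - (p * f1 y + (1 - p) * f0 y)) +
      enr n p (fun y => p * f1 y + (1 - p) * f0 y) = p * enr n p f1 + (1 - p) * enr n p f0 := by
  unfold enr
  simp only [Finset.mul_sum, ← muE_mul]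
  rw [← Finset.sum_add_distrib, ← Finset.sum_add_distrib, ← Finset.sum_add_distrib]
  refine Finset.sum_congr rfl fun i _ => ?_
  rw [← muE_add, ← muE_add, ← muE_add]
  congr 1; funext x
  simp only [grad]
  ring

/-- Falik–Samorodnitsky / Rossignol inequality -/
theorem main_ineq (p c : ℝ) (hp : 0 < p) (hp1 : p < 1) (hc : 2 ≤ c)
    (hcl : c * (1 - 2 * p) = Real.log (1 - p) - Real.log p)
    (W t : ℝ) (hW : 0 < W) (ht : 0 < t) (n : ℕ) :
    ∀ f : (Fin n → Bool) → ℝ,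
      (∀ j, 2 * (p * (1 - p)) * muE n p (fun x => |grad n j f x|) ≤ W) →
      (Real.log t + 1 - 2 * Real.log W) * varE n p f - n * t ≤
        c * (p * (1 - p)) * enr n p f := by
  induction n with
  | zero => intro f _; simp [varE, enr, muE_zero]
  | succ n ih =>
    intro f hf
    have hpq : 0 < p * (1 - p) := mul_pos hp (by linarith)
    set f1 : (Fin n → Bool) → ℝ := fun y => f (Fin.cons true y) with hf1
    set f0 : (Fin n → Bool) → ℝ := fun y => f (Fin.cons false y) with hf0
    set h : (Fin n → Bool) → ℝ := fun y => p * f1 y + (1 - p) * f0 y with hh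
    have ihh := ih h (by
      intro j
      refine le_trans ?_ (hf j.succ)
      refine mul_le_mul_of_nonneg_left ?_ (by positivity)
      rw [muE_succ]
      simp only [grad_succ_cons]
      rw [← muE_mul, ← muE_mul, ← muE_add]
      refine muE_mono n p hp hp1 _ _ fun y => ?_
      have e : grad n j h y = p * grad n j f1 y + (1 - p) * grad n j f0 y := by
        simp only [grad, hh]; ring
      rw [e]
      refine (abs_add_le _ _).trans ?_
      rw [abs_mul, abs_mul, abs_of_pos hp, abs_of_pos (show 0 < 1 - p by linarith)])
    set d : (Fin (n + 1) → Bool) → ℝ := fun x => f x - h (Fin.tail x) with hd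
    have d1 : ∀ y, d (Fin.cons true y) = (1 - p) * (f1 y - f0 y) := fun y => by
      simp only [hd, hh, Fin.tail_cons]
      rw [show f (Fin.cons true y) = f1 y from rfl]; ring
    have d0 : ∀ y, d (Fin.cons false y) = - (p * (f1 y - f0 y)) := fun y => by
      simp only [hd, hh, Fin.tail_cons]
      rw [show f (Fin.cons false y) = f0 y from rfl]; ring
    have dW : muE (n + 1) p (fun x => |d x|) ≤ W := by
      refine le_trans (le_of_eq ?_) (hf 0)
      rw [muE_succ, muE_succ]
      simp only [grad_zero_cons, d1, d0, abs_neg, abs_mul, abs_of_pos hp,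
        abs_of_pos (show 0 < 1 - p by linarith), muE_mul]
      ring
    have L := ent_lower (n + 1) p hp hp1 d W t hW ht dW
    have S := logsob p c hp hp1 hc hcl (n + 1) d
    have V : varE (n + 1) p f = varE n p h + muE (n + 1) p (fun x => d x ^ 2) := by
      unfold varE
      rw [muE_succ, muE_succ, muE_succ]
      simp only [d1, d0]
      have e1 : muE n p h = p * muE n p f1 + (1 - p) * muE n p f0 := by
        rw [← muE_mul, ← muE_mul, ← muE_add]
      rw [e1]
      have e2 : p * muE n p (fun y => f1 y ^ 2) + (1 - p) * muE n p (fun y => f0 y ^ 2) =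
          muE n p (fun y => h y ^ 2) + (p * muE n p (fun y => ((1 - p) * (f1 y - f0 y)) ^ 2) +
            (1 - p) * muE n p (fun y => (-(p * (f1 y - f0 y))) ^ 2)) := by
        simp only [← muE_mul, ← muE_add]
        congr 1; funext y; simp only [hh]; ring
      linarith
    have E : enr (n + 1) p f = enr n p h + enr (n + 1) p d := by
      rw [enr_succ, enr_succ, ← enr_sub_avg n p f1 f0]
      have e1 : (fun y => d (Fin.cons true y)) =
          fun y => f1 y - (p * f1 y + (1 - p) * f0 y) := by funext y; rw [d1]; ring
      have e0 : (fun y => d (Fin.cons false y)) =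
          fun y => f0 y - (p * f1 y + (1 - p) * f0 y) := by funext y; rw [d0]; ring
      have e2 : (fun y => (d (Fin.cons true y) - d (Fin.cons false y)) ^ 2) =
          fun y => (f1 y - f0 y) ^ 2 := by funext y; rw [d1, d0]; ring
      rw [e1, e0, e2]
      ring
    rw [V, E]
    push_cast
    linarith

/-! ### Conclusion -/

theorem infl_eq (n : ℕ) (p : ℝ) (j : Fin n) (f : (Fin n → Bool) → ℝ)
    (hbool : ∀ x, f x = 0 ∨ f x = 1) : infl n p j f = muE n p (fun x => |grad n j f x|) := by
  classical
  unfold infl muP muE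
  rw [Finset.sum_filter]
  refine Finset.sum_congr rfl fun x _ => ?_
  unfold grad
  rcases hbool (Function.update x j true) with h1 | h1 <;>
  rcases hbool (Function.update x j false) with h0 | h0 <;> simp [h1, h0]

theorem infl_eq' (n : ℕ) (p : ℝ) (j : Fin n) (f : (Fin n → Bool) → ℝ)
    (hbool : ∀ x, f x = 0 ∨ f x = 1) : infl n p j f = muE n p (fun x => grad n j f x ^ 2) := by
  rw [infl_eq n p j f hbool]
  congr 1; funext x
  unfold grad
  rcases hbool (Function.update x j true) with h1 | h1 <;>
  rcases hbool (Function.update x j false) with h0 | h0 <;> simp [h1, h0]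

theorem sseq_le (n : ℕ) : sseq n ≤ Real.log n - 2 * Real.log (Real.log n) := by
  unfold sseq
  have := le_max_right (Real.log ((Real.exp 1 ^ (2 + 4 / Real.exp 1) /
    (2 : ℝ) ^ (5 + 4 / Real.exp 1)) *
        Real.log ((n : ℝ) / Real.log n ^ 2) ^ (3 + 4 / Real.exp 1)))
      (2 * Real.log (Real.log n))
  linarith

theorem sseq_two : sseq 2 ≤ 2 * Real.log 2 := by
  have l1 := Real.log_two_gt_d9
  have l2 := Real.log_two_lt_d9
  have e1 := Real.exp_one_gt_d9
  have e2 := Real.exp_one_lt_d9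
  have hL : 1.38 ≤ Real.log ((2 : ℝ) / Real.log 2 ^ 2) := by
    have h4 : (4 : ℝ) ≤ 2 / Real.log 2 ^ 2 := by
      rw [le_div_iff₀ (by positivity)]; nlinarith
    have := Real.log_le_log (by norm_num) h4
    rw [show (4 : ℝ) = 2 ^ 2 by norm_num, Real.log_pow] at this
    push_cast at this
    linarith
  set L := Real.log ((2 : ℝ) / Real.log 2 ^ 2) with hLdef
  have hL0 : 0 < L := by linarith
  have hlogL : 0.27 ≤ Real.log L := by
    have h1 := Real.one_sub_inv_le_log_of_pos hL0
    have h2 : L⁻¹ ≤ (1.38 : ℝ)⁻¹ := inv_anti₀ (by norm_num) hL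
    norm_num at h1 h2 ⊢
    linarith
  set t := 4 / Real.exp 1 with ht
  have ht1 : 1.4 ≤ t := by rw [ht, le_div_iff₀ (by positivity)]; linarith
  have ht2 : t ≤ 1.5 := by rw [ht, div_le_iff₀ (by positivity)]; linarith
  have h := le_max_left (Real.log ((Real.exp 1 ^ (2 + t) / (2 : ℝ) ^ (5 + t)) * L ^ (3 + t)))
    (2 * Real.log (Real.log 2))
  have e : Real.log ((Real.exp 1 ^ (2 + t) / (2 : ℝ) ^ (5 + t)) * L ^ (3 + t)) =
      (2 + t) - (5 + t) * Real.log 2 + (3 + t) * Real.log L := by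
    rw [Real.log_mul (by positivity) (by positivity), Real.log_div (by positivity) (by positivity),
      Real.log_rpow (by positivity), Real.log_rpow (by positivity), Real.log_rpow hL0,
      Real.log_exp, mul_one]
  unfold sseq
  push_cast
  rw [← ht, ← hLdef]
  have : 4.4 * 0.27 ≤ (3 + t) * Real.log L :=
    mul_le_mul (by linarith) hlogL (by norm_num) (by linarith)
  nlinarith

/-- the numerical step -/
theorem num_step (n : ℕ) (hn : 2 ≤ n) (A : ℝ) (hA : 0 < A)
    (h : Real.log n + Real.log 4 - 2 * Real.log A ≤ A) : sseq n ≤ A := by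
  by_contra hlt
  push Not at hlt
  have hs0 : 0 < sseq n := hA.trans hlt
  have hlog : Real.log A ≤ Real.log (sseq n) := Real.log_le_log hA hlt.le
  have l4 : Real.log 4 = 2 * Real.log 2 := by
    rw [show (4 : ℝ) = 2 ^ 2 by norm_num, Real.log_pow]; push_cast; ring
  have l2 : 0 < Real.log 2 := Real.log_pos (by norm_num)
  have hh : Real.log n + 2 * Real.log 2 - 2 * Real.log (sseq n) < sseq n := by linarith
  rcases hn.eq_or_lt with h2 | h2
  · subst h2
    have h3 := sseq_two
    have h4 : Real.log (sseq 2) ≤ Real.log (2 * Real.log 2) := Real.log_le_log hs0 h3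
    have h5 : Real.log (2 * Real.log 2) ≤ Real.log 2 / 2 := by
      have := Real.log_two_lt_d9
      have l1 := Real.log_two_gt_d9
      have h6 : Real.log ((2 * Real.log 2) ^ 2) ≤ Real.log 2 :=
        Real.log_le_log (by positivity) (by nlinarith)
      rw [Real.log_pow] at h6
      push_cast at h6
      linarith
    push_cast at hh
    linarith
  · have hn3 : (3 : ℝ) ≤ n := by exact_mod_cast h2
    have hl1 : 1 ≤ Real.log n := by
      rw [Real.le_log_iff_exp_le (by linarith)]
      have := Real.exp_one_lt_d9
      linarith
    have hll : 0 ≤ Real.log (Real.log n) := Real.log_nonneg hl1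
    have h3 := sseq_le n
    have h4 : Real.log (sseq n) ≤ Real.log (Real.log n) := Real.log_le_log hs0 (by linarith)
    linarith

/-- Theorem 4.2: for every Boolean function `f` on `{0,1}^n` (`n ≥ 2`),
`max_j I_j(f) ≥ Var(f) s(n) / (n p(1-p) c_LS(p))`. -/
theorem stmt14 (n : ℕ) (hn : 2 ≤ n) (p : ℝ) (hp : p ∈ Set.Ioo (0 : ℝ) 1)
    (f : (Fin n → Bool) → ℝ) (hbool : ∀ x, f x = 0 ∨ f x = 1) :
    (⨆ j : Fin n, infl n p j f) ≥
      varE n p f * sseq n / (n * (p * (1 - p)) * cLS p) := by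
  obtain ⟨hp0, hp1⟩ := hp
  have hc := two_le_cLS p hp0 hp1
  have hcl := cLS_mul p
  set c := cLS p with hcdef
  have hpq : 0 < p * (1 - p) := mul_pos hp0 (by linarith)
  set q := p * (1 - p) with hq
  have hn0 : (0 : ℝ) < n := by exact_mod_cast (by omega : 0 < n)
  set δ := ⨆ j : Fin n, infl n p j f with hδ
  have hle : ∀ j, infl n p j f ≤ δ := fun j => 
    le_ciSup (f := fun j => infl n p j f) (Set.finite_range _).bddAbove j
  have hinf0 : ∀ j, 0 ≤ infl n p j f := fun j => by
    rw [infl_eq' n p j f hbool]; exact muE_nonneg n p hp0 hp1 _ fun x => sq_nonneg _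
  have hδ0 : 0 ≤ δ := (hinf0 ⟨0, by omega⟩).trans (hle _)
  have hE : enr n p f ≤ n * δ := by
    unfold enr
    calc _ ≤ ∑ _j : Fin n, δ := Finset.sum_le_sum fun j _ => by
          rw [← infl_eq' n p j f hbool]; exact hle j
      _ = n * δ := by simp
  have hveq : varE n p f = muE n p f - (muE n p f) ^ 2 := by
    unfold varE
    congr 2; funext x
    rcases hbool x with h | h <;> simp [h]
  have hv4 : varE n p f ≤ 1 / 4 := by
    rw [hveq]; nlinarith [sq_nonneg (muE n p f - 1 / 2)]
  have hv0 : 0 ≤ varE n p f := by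
    have m0 : 0 ≤ muE n p f := muE_nonneg n p hp0 hp1 _ fun x => by
      rcases hbool x with h | h <;> simp [h]
    have m1 : muE n p f ≤ 1 := by
      rw [← muE_const n p 1]
      exact muE_mono n p hp0 hp1 _ _ fun x => by rcases hbool x with h | h <;> simp [h]
    rw [hveq]; nlinarith
  set v := varE n p f with hv
  rcases hv0.eq_or_lt with h0 | hvpos
  · rw [← h0]; simpa using hδ0
  have main : ∀ W : ℝ, 0 < W → 2 * q * δ ≤ W →
      (Real.log (v / n) - 2 * Real.log W) * v ≤ c * q * (n * δ) := by
    intro W hW hWδ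
    have h1 := main_ineq p c hp0 hp1 hc hcl W (v / n) hW (by positivity) n f (fun j => by
      rw [← infl_eq n p j f hbool]
      exact (mul_le_mul_of_nonneg_left (hle j) (by positivity)).trans hWδ)
    have h2 := mul_le_mul_of_nonneg_left hE (show 0 ≤ c * q by positivity)
    have h3 : (n : ℝ) * (v / n) = v := by field_simp
    rw [h3, ← hv] at h1
    linarith
  rcases hδ0.eq_or_lt with hd0 | hdpos
  · exfalso
    have h1 := main (√(v / n) / 2) (by positivity) (by rw [← hd0, mul_zero]; positivity)
    rw [← hd0, Real.log_div (x := √(v / n)) (y := 2) (by positivity) (by norm_num),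
      Real.log_sqrt (by positivity)] at h1
    have l2 : 0 < Real.log 2 := Real.log_pos (by norm_num)
    nlinarith [mul_pos l2 hvpos]
  · have h1 := main (2 * q * δ) (by positivity) le_rfl
    set A := c * q * (n * δ) / v with hA
    have hApos : 0 < A := by positivity
    have h2 : Real.log (v / n) - 2 * Real.log (2 * q * δ) ≤ A := by
      rw [hA, le_div_iff₀ hvpos]; exact h1
    have h3 : sseq n ≤ A := by
      refine num_step n hn A hApos (le_trans ?_ h2)
      have lA : Real.log A = Real.log c + Real.log q + (Real.log n + Real.log δ) - Real.log v := by
        rw [hA, Real.log_div (by positivity) (by positivity), Real.log_mul (x := c * q) (by positivity)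
          (by positivity), Real.log_mul (x := c) (by positivity) (by positivity),
          Real.log_mul (x := (n : ℝ)) (by positivity) (by positivity)]
      have lW : Real.log (2 * q * δ) = Real.log 2 + Real.log q + Real.log δ := by
        rw [Real.log_mul (by positivity) (by positivity),
          Real.log_mul (by positivity) (by positivity)]
      have l4 : Real.log 4 = 2 * Real.log 2 := by
        rw [show (4 : ℝ) = 2 ^ 2 by norm_num, Real.log_pow]; push_cast; ring
      have lc : Real.log 2 ≤ Real.log c := Real.log_le_log (by norm_num) hc
      have lv : Real.log v ≤ - Real.log 4 := by
        rw [← Real.log_inv]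
        exact Real.log_le_log hvpos (by linarith)
      rw [lA, lW, Real.log_div (by positivity) (by positivity)]
      linarith
    rw [ge_iff_le, div_le_iff₀ (by positivity)]
    rw [hA, le_div_iff₀ hvpos] at h3
    linarith
end
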